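/- arXiv:2012.12977 — 10 statements merged into one kernel-verified Lean document; each statement's English description precedes it below -/
import Mathlib

section
/- Let q be a prime power, F a finite field with q² elements, and let Φ ∈ F^{d×n} be a frame for the complex model on F^d (i.e., rank Φ = d). Then for any c ∈ F, Φ·Φ* = c·I if and only if (Φ*·Φ)² = c·(Φ*·Φ). -/
open Matrix

/-- The conjugate transpose over a finite field with `q^2` elements, where conjugation
is `x ↦ x ^ q`. -/
def conjT {F : Type*} [Field F] (q : ℕ) {m n : Type*} (A : Matrix m n F) : Matrix n m F :=
  Matrix.of fun i j => (A j i) ^ q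

/-- On a finite field of cardinality `q ^ 2`, the map `x ↦ x ^ q` is a ring homomorphism. -/
theorem exists_ringHom_pow_of_card_eq_sq {F : Type*} [Field F] [Fintype F] {q : ℕ}
    (hF : Fintype.card F = q ^ 2) : ∃ f : F →+* F, ∀ x, f x = x ^ q := by
  obtain ⟨p, hp⟩ := CharP.exists F
  obtain ⟨m, hprime, hcard⟩ := FiniteField.card F p
  have : Fact p.Prime := ⟨hprime⟩
  obtain ⟨k, -, rfl⟩ := (Nat.dvd_prime_pow hprime).1
    (show q ∣ p ^ (m : ℕ) from hcard ▸ hF ▸ dvd_pow_self q two_ne_zero)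
  exact ⟨iterateFrobenius F p k, fun x => iterateFrobenius_def p k x⟩

/-- A matrix of full row rank over a field has a right inverse. -/
theorem Matrix.exists_right_inverse_of_rank_eq_card {F m n : Type*} [Field F] [Fintype m]
    [DecidableEq m] [Fintype n] {A : Matrix m n F} (hA : A.rank = Fintype.card m) :
    ∃ B : Matrix n m F, A * B = 1 := by
  rw [← Matrix.mulVec_surjective_iff_exists_right_inverse]
  have h : LinearMap.range A.mulVecLin = ⊤ :=
    Submodule.eq_top_of_finrank_eq (by rw [Module.finrank_fintype_fun_eq_card]; exact hA)
  exact LinearMap.range_eq_top.1 h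

/-- For a frame `Φ` in the complex model on `F^d` (i.e. `rank Φ = d`), `Φ Φ* = c • I` iff
`(Φ* Φ)^2 = c • (Φ* Φ)`. -/
theorem stmt_0 (q d n : ℕ) (hq : IsPrimePow q)
    (F : Type*) [Field F] [Fintype F] (hF : Fintype.card F = q ^ 2)
    (Φ : Matrix (Fin d) (Fin n) F) (hΦ : Φ.rank = d) (c : F) :
    Φ * conjT q Φ = c • (1 : Matrix (Fin d) (Fin d) F) ↔
      (conjT q Φ * Φ) * (conjT q Φ * Φ) = c • (conjT q Φ * Φ) := by
  obtain ⟨f, hf⟩ := exists_ringHom_pow_of_card_eq_sq hF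
  obtain ⟨B, hB⟩ := Matrix.exists_right_inverse_of_rank_eq_card (A := Φ) (by simpa using hΦ)
  have hconj : conjT q Φ = Φᵀ.map f := by
    ext i j
    simp [conjT, hf]
  have hB' : Bᵀ.map f * conjT q Φ = 1 := by
    rw [hconj, ← Matrix.map_mul, ← Matrix.transpose_mul, hB]
    simp
  constructor
  · intro h
    calc (conjT q Φ * Φ) * (conjT q Φ * Φ) = conjT q Φ * (Φ * conjT q Φ) * Φ := by
          simp only [Matrix.mul_assoc]
      _ = c • (conjT q Φ * Φ) := by simp [h]
  · intro h
    calc Φ * conjT q Φ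
        = (Bᵀ.map f * conjT q Φ) * (Φ * conjT q Φ) * (Φ * B) := by simp [hB, hB']
      _ = Bᵀ.map f * ((conjT q Φ * Φ) * (conjT q Φ * Φ)) * B := by
          simp only [Matrix.mul_assoc]
      _ = c • ((Bᵀ.map f * conjT q Φ) * (Φ * B)) := by
          rw [h]
          simp only [Matrix.mul_smul, Matrix.smul_mul, Matrix.mul_assoc]
      _ = c • (1 : Matrix (Fin d) (Fin d) F) := by simp [hB, hB']
end

section
/- Let q be a prime power and F a finite field with q² elements. If Φ ∈ F^{d×n} is a frame for the complex model on F^d with Φ·Φ* = 0 (a totally isotropic tight frame), then n ≥ 2d. -/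
open Matrix

/-- A ring homomorphism applied entrywise keeps full row rank. -/
theorem Matrix.card_le_rank_map_of_rank_eq {m n F K : Type*} [Fintype m] [Fintype n] [Field F]
    [Field K] (f : F →+* K) {A : Matrix m n F} (hA : A.rank = Fintype.card m) :
    Fintype.card m ≤ (A.map f).rank := by
  classical
  have htop : LinearMap.range A.mulVecLin = ⊤ :=
    Submodule.eq_top_of_finrank_eq (hA.trans (Module.finrank_fintype_fun_eq_card F).symm)
  obtain ⟨B, hB⟩ := Matrix.mulVec_surjective_iff_exists_right_inverse.mp
    (LinearMap.range_eq_top.mp htop)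
  have hmap : A.map f * B.map f = 1 := by
    rw [← Matrix.map_mul, hB, Matrix.map_one f f.map_zero f.map_one]
  calc Fintype.card m = (A.map f * B.map f).rank := by rw [hmap, Matrix.rank_one]
    _ ≤ (A.map f).rank := Matrix.rank_mul_le_left _ _

/-- In a finite field with `q ^ 2` elements, `x ↦ x ^ q` is a ring homomorphism. -/
theorem exists_ringHom_eq_pow_of_card_eq_sq {q : ℕ} (hq : IsPrimePow q) {F : Type*} [Field F]
    [Fintype F] (hF : Fintype.card F = q ^ 2) : ∃ f : F →+* F, ∀ x, f x = x ^ q := by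
  obtain ⟨p, k, hp, -, rfl⟩ := (isPrimePow_nat_iff q).mp hq
  have : Fact p.Prime := ⟨hp⟩
  have : CharP F p := charP_of_card_eq_prime_pow (hF.trans (pow_mul p k 2).symm)
  exact ⟨iterateFrobenius F p k, fun x => iterateFrobenius_def p k x⟩

/-- A totally isotropic tight frame (`Φ Φ* = 0`) of `n` vectors in the complex model on `F^d`
satisfies `n ≥ 2d`. -/
theorem stmt_1 (q d n : ℕ) (hq : IsPrimePow q)
    (F : Type*) [Field F] [Fintype F] (hF : Fintype.card F = q ^ 2)
    (Φ : Matrix (Fin d) (Fin n) F) (hΦ : Φ.rank = d)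
    (htight : Φ * conjT q Φ = 0) :
    2 * d ≤ n := by
  obtain ⟨f, hf⟩ := exists_ringHom_eq_pow_of_card_eq_sq hq hF
  have hconj : conjT q Φ = (Φ.map f)ᵀ := by
    ext i j
    simp [conjT, hf]
  have hrank : d ≤ (conjT q Φ).rank := by
    rw [hconj, Matrix.rank_transpose]
    simpa using Matrix.card_le_rank_map_of_rank_eq f (A := Φ) (by simpa using hΦ)
  have hle := Matrix.rank_add_rank_le_card_of_mul_eq_zero htight
  rw [hΦ, Fintype.card_fin] at hle
  omega
end

section
/- Let q be a prime power, F a finite field with q² elements, Φ ∈ F^{d×n} a frame for the complex model on F^d, and let W ⊆ F^n be the column space of Φ*. Then the frame operator Φ·Φ* is invertible if and only if W is a nondegenerate subspace of F^n, i.e., the only w ∈ W satisfying ∑_i (w_i)^q·y_i = 0 for every y ∈ W is w = 0. -/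
open Matrix

/-- Over a field with `q ^ 2` elements, `x ↦ x ^ q` is an involutive ring endomorphism. -/
theorem exists_involutive_ringHom_pow {F : Type*} [Field F] [Fintype F] {q : ℕ}
    (hF : Fintype.card F = q ^ 2) :
    ∃ σ : F →+* F, (∀ x, σ x = x ^ q) ∧ ∀ x, σ (σ x) = x := by
  obtain ⟨p, hp⟩ := CharP.exists F
  obtain ⟨k, hprime, hk⟩ := FiniteField.card F p
  have : Fact p.Prime := ⟨hprime⟩
  have hdvd : q ∣ p ^ (k : ℕ) := by
    rw [← hk, hF]
    exact dvd_pow_self q two_ne_zero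
  obtain ⟨j, -, rfl⟩ := (Nat.dvd_prime_pow hprime).1 hdvd
  refine ⟨iterateFrobenius F p j, fun x => iterateFrobenius_def p j x, fun x => ?_⟩
  rw [iterateFrobenius_def, iterateFrobenius_def, ← pow_mul, ← sq, ← hF]
  exact FiniteField.pow_card x

theorem Matrix.vecMul_injective_of_rank_eq {K : Type*} [Field K] {d n : ℕ}
    {A : Matrix (Fin d) (Fin n) K} (hA : A.rank = d) : Function.Injective A.vecMul := by
  rw [Matrix.vecMul_injective_iff, linearIndependent_iff_card_eq_finrank_span,
    Set.finrank, ← Matrix.rank_eq_finrank_span_row, hA, Fintype.card_fin]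

theorem map_conjT_mulVec {F : Type*} [Field F] {q d n : ℕ} {σ : F →+* F}
    (hσ : ∀ x, σ x = x ^ q) (hσσ : ∀ x, σ (σ x) = x)
    (A : Matrix (Fin d) (Fin n) F) (a : Fin d → F) (i : Fin n) :
    σ ((conjT q A *ᵥ a) i) = ((σ ∘ a) ᵥ* A) i := by
  simp only [Matrix.mulVec, Matrix.vecMul, dotProduct, conjT, Matrix.of_apply, map_sum,
    map_mul, ← hσ, hσσ, Function.comp_apply]
  exact Finset.sum_congr rfl fun k _ => mul_comm _ _

/-- The form on the column space of `A*`, pulled back along `A*`, is the form of `A A*`. -/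
theorem sum_conjT_mulVec_pow_mul {F : Type*} [Field F] {q d n : ℕ} {σ : F →+* F}
    (hσ : ∀ x, σ x = x ^ q) (hσσ : ∀ x, σ (σ x) = x)
    (A : Matrix (Fin d) (Fin n) F) (a b : Fin d → F) :
    ∑ i, (conjT q A *ᵥ a) i ^ q * (conjT q A *ᵥ b) i =
      ((σ ∘ a) ᵥ* (A * conjT q A)) ⬝ᵥ b := by
  rw [← Matrix.vecMul_vecMul, ← Matrix.dotProduct_mulVec]
  simp only [← hσ, map_conjT_mulVec hσ hσσ, dotProduct]

/-- For a frame `Φ` in the complex model on `F^d`, the frame operator `Φ Φ*` is invertible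
iff the column space `W` of `Φ*` is a nondegenerate subspace of `F^n`. -/
theorem stmt_2 (q d n : ℕ) (hq : IsPrimePow q)
    (F : Type*) [Field F] [Fintype F] (hF : Fintype.card F = q ^ 2)
    (Φ : Matrix (Fin d) (Fin n) F) (hΦ : Φ.rank = d) :
    IsUnit (Φ * conjT q Φ) ↔
      ∀ w ∈ LinearMap.range (conjT q Φ).mulVecLin,
        (∀ y ∈ LinearMap.range (conjT q Φ).mulVecLin, ∑ i, (w i) ^ q * y i = 0) → w = 0 := by
  obtain ⟨σ, hσ, hσσ⟩ := exists_involutive_ringHom_pow hF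
  rw [← Matrix.vecMul_injective_iff_isUnit]
  constructor
  · rintro hG _ ⟨a, rfl⟩ hw
    have hz : (σ ∘ a) ᵥ* (Φ * conjT q Φ) = 0 := by
      refine dotProduct_eq_zero _ fun b => ?_
      rw [← sum_conjT_mulVec_pow_mul hσ hσσ]
      exact hw _ ⟨b, rfl⟩
    have ha : σ ∘ a = 0 := hG (hz.trans (Matrix.zero_vecMul _).symm)
    have ha' : a = 0 := funext fun k => by
      simpa using congrFun ha k
    rw [ha', map_zero]
  · intro h
    refine (injective_iff_map_eq_zero (Φ * conjT q Φ).vecMulLinear).2 fun v hv => ?_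
    have hv' : v ᵥ* (Φ * conjT q Φ) = 0 := hv
    have hσv : σ ∘ (σ ∘ v) = v := funext fun k => hσσ (v k)
    have hw : conjT q Φ *ᵥ (σ ∘ v) = 0 := by
      refine h _ ⟨σ ∘ v, rfl⟩ ?_
      rintro _ ⟨b, rfl⟩
      simp only [Matrix.mulVecLin_apply]
      rw [sum_conjT_mulVec_pow_mul hσ hσσ, hσv, hv', zero_dotProduct]
    have hvΦ : v ᵥ* Φ = 0 := funext fun i => by
      have hi := map_conjT_mulVec hσ hσσ Φ (σ ∘ v) i
      rw [hσv, hw] at hi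
      simpa using hi.symm
    exact Matrix.vecMul_injective_of_rank_eq hΦ (hvΦ.trans (Matrix.zero_vecMul _).symm)
end

section
/- Let q be a prime power, F a finite field with q² elements, and let Φ, Ψ ∈ F^{d×n} be frames for the complex model on F^d. For any c ∈ F with c ≠ 0, one has Ψ*·Ψ = c·(Φ*·Φ) if and only if there exists a matrix A ∈ F^{d×d} with A*·A = c·I and Ψ = A·Φ; moreover such an A is unique. -/
open Matrix

lemma conjT_one {F : Type*} [Field F] {q : ℕ} (hq : q ≠ 0) {m : Type*} [DecidableEq m] :
    conjT q (1 : Matrix m m F) = 1 := by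
  ext i j
  by_cases h : i = j
  · subst h
    simp [conjT]
  · simp [conjT, Matrix.one_apply_ne h, Matrix.one_apply_ne (Ne.symm h), hq]

/-- The `q`-power conjugate transpose reverses products over a field with `q ^ 2` elements. -/
lemma conjT_mul {F : Type*} [Field F] [Fintype F] {q : ℕ} (hq : IsPrimePow q)
    (hF : Fintype.card F = q ^ 2) {l m n : Type*} [Fintype m]
    (A : Matrix l m F) (B : Matrix m n F) :
    conjT q (A * B) = conjT q B * conjT q A := by
  obtain ⟨p, k, hp, hk, rfl⟩ := hq
  obtain ⟨r, hr⟩ := CharP.exists F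
  obtain ⟨a, hrp, ha⟩ := FiniteField.card F r
  have hdvd : r ∣ p := by
    have h : r ∣ (p ^ k) ^ 2 := by
      rw [← hF, ha]
      exact dvd_pow_self r a.ne_zero
    exact hrp.dvd_of_dvd_pow (hrp.dvd_of_dvd_pow h)
  obtain rfl := (Nat.prime_dvd_prime_iff_eq hrp hp.nat_prime).mp hdvd
  have : Fact r.Prime := ⟨hrp⟩
  ext i j
  simp only [conjT, Matrix.of_apply, Matrix.mul_apply, sum_pow_char_pow, mul_pow]
  exact Finset.sum_congr rfl fun _ _ => mul_comm _ _

lemma exists_mul_eq_one_of_rank_eq {F : Type*} [Field F] {d n : ℕ}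
    (Φ : Matrix (Fin d) (Fin n) F) (h : Φ.rank = d) :
    ∃ R : Matrix (Fin n) (Fin d) F, Φ * R = 1 := by
  refine Matrix.mulVec_surjective_iff_exists_right_inverse.mp ?_
  have htop : LinearMap.range Φ.mulVecLin = ⊤ :=
    Submodule.eq_top_of_finrank_eq (by simpa [Matrix.rank] using h)
  exact LinearMap.range_eq_top.mp htop

/-- For frames `Φ`, `Ψ` in the complex model on `F^d` and `c ≠ 0`:
`Ψ* Ψ = c • (Φ* Φ)` iff there is a unique `A` with `A* A = c • I` and `Ψ = A Φ`. -/
theorem stmt_4 (q d n : ℕ) (hq : IsPrimePow q)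
    (F : Type*) [Field F] [Fintype F] (hF : Fintype.card F = q ^ 2)
    (Φ Ψ : Matrix (Fin d) (Fin n) F) (hΦ : Φ.rank = d) (hΨ : Ψ.rank = d)
    (c : F) (hc : c ≠ 0) :
    conjT q Ψ * Ψ = c • (conjT q Φ * Φ) ↔
      ∃! A : Matrix (Fin d) (Fin d) F,
        conjT q A * A = c • (1 : Matrix (Fin d) (Fin d) F) ∧ Ψ = A * Φ := by
  obtain ⟨R, hR⟩ := exists_mul_eq_one_of_rank_eq Φ hΦ
  obtain ⟨S, hS⟩ := exists_mul_eq_one_of_rank_eq Ψ hΨ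
  have left_inv {m : ℕ} {X : Matrix (Fin d) (Fin m) F} {Y : Matrix (Fin m) (Fin d) F}
      (h : X * Y = 1) : conjT q Y * conjT q X = 1 := by
    rw [← conjT_mul hq hF, h, conjT_one hq.ne_zero]
  constructor
  · intro h
    refine ⟨Ψ * R, ⟨?_, ?_⟩, ?_⟩
    · calc conjT q (Ψ * R) * (Ψ * R) = conjT q R * (conjT q Ψ * Ψ) * R := by
            simp only [conjT_mul hq hF, Matrix.mul_assoc]
        _ = c • ((conjT q R * conjT q Φ) * (Φ * R)) := by
            simp only [h, Matrix.mul_smul, Matrix.smul_mul, Matrix.mul_assoc]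
        _ = c • 1 := by rw [left_inv hR, hR, Matrix.mul_one]
    · have hgram : conjT q Ψ * Ψ = conjT q Ψ * (Ψ * R * Φ) := by
        calc conjT q Ψ * Ψ = c • (conjT q Φ * ((Φ * R) * Φ)) := by rw [hR, Matrix.one_mul, h]
          _ = (c • (conjT q Φ * Φ)) * (R * Φ) := by
            simp only [Matrix.smul_mul, Matrix.mul_assoc]
          _ = conjT q Ψ * (Ψ * R * Φ) := by rw [← h]; simp only [Matrix.mul_assoc]
      have hcancel := congrArg (conjT q S * ·) hgram
      simpa only [← Matrix.mul_assoc (conjT q S), left_inv hS, Matrix.one_mul] using hcancel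
    · rintro A ⟨-, hA⟩
      rw [hA, Matrix.mul_assoc, hR, Matrix.mul_one]
  · rintro ⟨A, ⟨hA, rfl⟩, -⟩
    calc conjT q (A * Φ) * (A * Φ) = conjT q Φ * (conjT q A * A) * Φ := by
          simp only [conjT_mul hq hF, Matrix.mul_assoc]
      _ = c • (conjT q Φ * Φ) := by
          rw [hA, Matrix.mul_smul, Matrix.smul_mul, Matrix.mul_one]
end

section
/- Let q be a prime power and F a finite field with q² elements. A matrix G ∈ F^{n×n} satisfies G* = G and rank G = d if and only if there exists Φ ∈ F^{d×n} with rank Φ = d and Φ*·Φ = G; that is, G is the Gram matrix of a frame of n vectors for the complex model on F^d exactly when G is Hermitian of rank d. -/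
open Matrix

theorem Matrix.IsHermitian.star_star_dotProduct_mulVec {F n : Type*} [CommRing F] [StarRing F]
    [Fintype n] {G : Matrix n n F} (hG : G.IsHermitian) (x y : n → F) :
    star (star x ⬝ᵥ (G *ᵥ y)) = star y ⬝ᵥ (G *ᵥ x) := by
  rw [← star_dotProduct, star_mulVec, hG, ← dotProduct_mulVec]

/-- If the trace of the involution is nonzero, a nonzero Hermitian matrix has a
nonisotropic vector. -/
theorem exists_star_dotProduct_mulVec_ne_zero {F n : Type*} [Field F] [StarRing F] [Fintype n]
    [DecidableEq n] (htr : ∃ a : F, a + star a ≠ 0) {G : Matrix n n F} (hG : G.IsHermitian)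
    (hG0 : G ≠ 0) : ∃ x : n → F, star x ⬝ᵥ (G *ᵥ x) ≠ 0 := by
  by_contra! hiso
  obtain ⟨a, ha⟩ := htr
  obtain ⟨i, j, hij⟩ : ∃ i j, G i j ≠ 0 := by
    by_contra! h
    exact hG0 (Matrix.ext h)
  have hadd (x y : n → F) : star x ⬝ᵥ (G *ᵥ y) + star (star x ⬝ᵥ (G *ᵥ y)) = 0 := by
    have h := hiso (x + y)
    rw [star_add, mulVec_add, add_dotProduct, dotProduct_add, dotProduct_add, hiso x, hiso y,
      ← hG.star_star_dotProduct_mulVec x y] at h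
    simpa using h
  have h := hadd (Pi.single i 1) (Pi.single j (a / G i j))
  have hval : star (Pi.single i 1 : n → F) ⬝ᵥ (G *ᵥ Pi.single j (a / G i j)) = a := by
    rw [← Pi.single_star, star_one, single_one_dotProduct, mulVec_single]
    simp
    field_simp
  rw [hval] at h
  exact ha h

/-- Subtracting from `G` the rank-one Hermitian matrix attached to a vector of norm one
lowers the rank. -/
theorem rank_sub_vecMulVec_lt {F n : Type*} [Field F] [StarRing F] [Fintype n]
    {G : Matrix n n F} (hG : G.IsHermitian) {x : n → F} (hx : star x ⬝ᵥ (G *ᵥ x) = 1) :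
    (G - vecMulVec (G *ᵥ x) (star (G *ᵥ x))).rank < G.rank := by
  have hmul (y : n → F) : (G - vecMulVec (G *ᵥ x) (star (G *ᵥ x))) *ᵥ y =
      G *ᵥ y - (star x ⬝ᵥ (G *ᵥ y)) • (G *ᵥ x) := by
    rw [sub_mulVec, vecMulVec_mulVec, star_mulVec, hG, ← dotProduct_mulVec]
    simp
  have hlt : LinearMap.ker G.mulVecLin <
      LinearMap.ker (G - vecMulVec (G *ᵥ x) (star (G *ᵥ x))).mulVecLin := by
    refine SetLike.lt_iff_le_and_exists.2 ⟨fun y hy => ?_, x, ?_, fun h => ?_⟩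
    · rw [LinearMap.mem_ker, mulVecLin_apply] at hy ⊢
      simp [hmul, hy]
    · rw [LinearMap.mem_ker, mulVecLin_apply, hmul, hx, one_smul, sub_self]
    · rw [LinearMap.mem_ker, mulVecLin_apply] at h
      simp [h] at hx
  have hker := Submodule.finrank_lt_finrank_of_lt hlt
  have h₁ := G.mulVecLin.finrank_range_add_finrank_ker
  have h₂ := (G - vecMulVec (G *ᵥ x) (star (G *ᵥ x))).mulVecLin.finrank_range_add_finrank_ker
  unfold Matrix.rank
  omega

/-- A Hermitian matrix of rank at most `d` is a Gram matrix of vectors of length `d`, provided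
the involution has nonzero trace and every fixed element is a norm. -/
theorem exists_conjTranspose_mul_self_eq {F n : Type*} [Field F] [StarRing F] [Fintype n]
    [DecidableEq n] (htr : ∃ a : F, a + star a ≠ 0)
    (hnorm : ∀ c : F, star c = c → ∃ t, star t * t = c) (d : ℕ) (G : Matrix n n F)
    (hG : G.IsHermitian) (hd : G.rank ≤ d) : ∃ Φ : Matrix (Fin d) n F, Φᴴ * Φ = G := by
  induction d generalizing G with
  | zero =>
    refine ⟨0, ?_⟩
    have h : G.mulVecLin = 0 := by
      rw [← LinearMap.range_eq_bot, ← Submodule.finrank_eq_zero (R := F)]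
      exact Nat.le_zero.1 hd
    rw [Matrix.mul_zero, eq_comm]
    exact ext_of_mulVec_single fun i => by
      rw [zero_mulVec]
      exact LinearMap.congr_fun h (Pi.single i 1)
  | succ d ih =>
    by_cases hG0 : G = 0
    · exact ⟨0, by simp [hG0]⟩
    obtain ⟨y, hy⟩ := exists_star_dotProduct_mulVec_ne_zero htr hG hG0
    have hfix : star (star y ⬝ᵥ (G *ᵥ y))⁻¹ = (star y ⬝ᵥ (G *ᵥ y))⁻¹ := by
      rw [star_inv₀, hG.star_star_dotProduct_mulVec]
    obtain ⟨t, ht⟩ := hnorm _ hfix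
    have hx : star (t • y) ⬝ᵥ (G *ᵥ (t • y)) = 1 := by
      rw [star_smul, mulVec_smul, smul_dotProduct, dotProduct_smul, smul_smul, ht, smul_eq_mul,
        inv_mul_cancel₀ hy]
    set v := G *ᵥ (t • y)
    obtain ⟨Ψ, hΨ⟩ := ih (G - vecMulVec v (star v))
      (hG.sub (by rw [IsHermitian, conjTranspose_vecMulVec, star_star]))
      (Nat.le_of_lt_succ ((rank_sub_vecMulVec_lt hG hx).trans_le hd))
    refine ⟨Matrix.of (vecCons (star v) Ψ), ?_⟩
    ext i j
    have h := congrFun (congrFun hΨ i) j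
    simp only [mul_apply, conjTranspose_apply, Matrix.sub_apply, vecMulVec_apply] at h
    rw [mul_apply, Fin.sum_univ_succ]
    change star (star v i) * star v j + ∑ k, star (Ψ k i) * Ψ k j = G i j
    rw [h, Pi.star_apply, star_star]
    ring

/-- The Gram matrix of a spanning family has full rank. -/
theorem rank_conjTranspose_mul_self_of_rank_eq_card {F m n : Type*} [Field F] [StarRing F]
    [Fintype m] [Fintype n] {Φ : Matrix m n F} (h : Φ.rank = Fintype.card m) :
    (Φᴴ * Φ).rank = Φ.rank := by
  classical
  have hsurj : Function.Surjective Φ.mulVec := by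
    have : LinearMap.range Φ.mulVecLin = ⊤ :=
      Submodule.eq_top_of_finrank_eq (by simpa [Matrix.rank] using h)
    exact LinearMap.range_eq_top.1 this
  obtain ⟨Ψ, hΨ⟩ := mulVec_surjective_iff_exists_right_inverse.1 hsurj
  refine le_antisymm (rank_mul_le_right _ _) ?_
  calc Φ.rank = (Ψᴴ * (Φᴴ * Φ)).rank := by
        rw [← Matrix.mul_assoc, ← conjTranspose_mul, hΨ, conjTranspose_one, Matrix.one_mul]
    _ ≤ _ := rank_mul_le_right _ _

theorem FiniteField.add_pow_of_card_eq_sq {F : Type*} [Field F] [Fintype F] {q : ℕ}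
    (hq : IsPrimePow q) (hF : Fintype.card F = q ^ 2) (x y : F) :
    (x + y) ^ q = x ^ q + y ^ q := by
  obtain ⟨p, k, hp, hk, rfl⟩ := (isPrimePow_nat_iff q).1 hq
  have := Fact.mk hp
  have : CharP F p := charP_of_card_eq_prime_pow (f := k * 2) (by rw [hF, pow_mul])
  exact add_pow_char_pow x y p k

/-- Conjugation `x ↦ x ^ q` makes a field with `q ^ 2` elements a star ring. -/
abbrev FiniteField.starRingOfCardEqSq {F : Type*} [Field F] [Fintype F] {q : ℕ}
    (hq : IsPrimePow q) (hF : Fintype.card F = q ^ 2) : StarRing F where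
  star x := x ^ q
  star_involutive x := by
    change (x ^ q) ^ q = x
    rw [← pow_mul, ← sq, ← hF, FiniteField.pow_card]
  star_mul x y := by
    change (x * y) ^ q = y ^ q * x ^ q
    rw [mul_pow, mul_comm]
  star_add x y := FiniteField.add_pow_of_card_eq_sq hq hF x y

theorem FiniteField.exists_add_pow_ne_zero {F : Type*} [Field F] [Fintype F] {q : ℕ}
    (hq : 1 < q) (hF : Fintype.card F = q ^ 2) : ∃ a : F, a + a ^ q ≠ 0 := by
  by_contra! h
  have hdeg : (Polynomial.X + Polynomial.X ^ q : Polynomial F).natDegree = q := by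
    compute_degree!
    · simp [hq.ne]
    · exact hq.le
  have h0 : (Polynomial.X + Polynomial.X ^ q : Polynomial F) = 0 := by
    refine Polynomial.eq_zero_of_natDegree_lt_card_of_eval_eq_zero _ Function.injective_id
      (fun a => by simpa using h a) ?_
    rw [hdeg, hF]
    nlinarith
  rw [h0, Polynomial.natDegree_zero] at hdeg
  omega

theorem FiniteField.exists_pow_mul_self_eq {F : Type*} [Field F] [Fintype F] {q : ℕ}
    (hq : 1 < q) (hF : Fintype.card F = q ^ 2) (c : F) (hc : c ^ q = c) :
    ∃ t, t ^ q * t = c := by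
  rcases eq_or_ne c 0 with rfl | hc0
  · exact ⟨0, mul_zero _⟩
  obtain ⟨r, rfl⟩ : ∃ r, q = r + 1 := ⟨q - 1, by omega⟩
  classical
  obtain ⟨g, hgen⟩ := IsCyclic.exists_monoid_generator (α := Fˣ)
  have hg := orderOf_eq_card_of_forall_mem_powers hgen
  have hcard : Nat.card Fˣ = r * (r + 1 + 1) := by
    rw [Nat.card_eq_fintype_card, Fintype.card_units, hF, Nat.sub_eq_iff_eq_add (Nat.one_le_pow 2 (r + 1) r.succ_pos)]
    ring
  obtain ⟨m, hm⟩ := hgen (Units.mk0 c hc0)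
  have hm1 : g ^ (r * m) = 1 := by
    have : (Units.mk0 c hc0) ^ r = 1 := by
      ext
      exact mul_right_cancel₀ hc0 (by simpa [pow_succ] using hc)
    rw [mul_comm, pow_mul]
    exact (congrArg (· ^ r) hm).trans this
  obtain ⟨s, rfl⟩ : r + 1 + 1 ∣ m := by
    have := orderOf_dvd_of_pow_eq_one hm1
    rw [hg, hcard] at this
    exact Nat.dvd_of_mul_dvd_mul_left (by omega) this
  refine ⟨((g ^ s : Fˣ) : F), ?_⟩
  have := congrArg Units.val hm
  simp only [Units.val_pow_eq_pow_val, Units.val_mk0] at this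
  rw [← this, ← pow_succ, Units.val_pow_eq_pow_val, ← pow_mul, mul_comm]

/-- `G ∈ F^{n×n}` is Hermitian of rank `d` iff it is the Gram matrix of a frame of
`n` vectors for the complex model on `F^d`. -/
theorem stmt_5 (q d n : ℕ) (hq : IsPrimePow q)
    (F : Type*) [Field F] [Fintype F] (hF : Fintype.card F = q ^ 2)
    (G : Matrix (Fin n) (Fin n) F) :
    (conjT q G = G ∧ G.rank = d) ↔
      ∃ Φ : Matrix (Fin d) (Fin n) F, Φ.rank = d ∧ conjT q Φ * Φ = G := by
  let _ : StarRing F := FiniteField.starRingOfCardEqSq hq hF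
  change (Gᴴ = G ∧ G.rank = d) ↔ ∃ Φ : Matrix (Fin d) (Fin n) F, Φ.rank = d ∧ Φᴴ * Φ = G
  constructor
  · rintro ⟨hG, hd⟩
    obtain ⟨Φ, hΦ⟩ := exists_conjTranspose_mul_self_eq
      (FiniteField.exists_add_pow_ne_zero hq.one_lt hF)
      (FiniteField.exists_pow_mul_self_eq hq.one_lt hF) d G hG hd.le
    refine ⟨Φ, le_antisymm Φ.rank_le_height ?_, hΦ⟩
    calc d = (Φᴴ * Φ).rank := by rw [hΦ, hd]
      _ ≤ Φ.rank := rank_mul_le_right _ _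
  · rintro ⟨Φ, hd, rfl⟩
    refine ⟨by rw [conjTranspose_mul, conjTranspose_conjTranspose], ?_⟩
    rw [rank_conjTranspose_mul_self_of_rank_eq_card (by rw [hd, Fintype.card_fin]), hd]
end

section
/- Let q be an odd prime power and F = F_q. Let G ∈ F^{n×n} satisfy Gᵀ = G and rank G = d, let I be a set of d column indices such that the columns of G indexed by I form a basis of the column space of G, and set G_b = (G_{ij})_{i,j∈I}. Let M ∈ F^{d×d} be symmetric and invertible. Then there exists Φ ∈ F^{d×n} with rank Φ = d and Φᵀ·M·Φ = G if and only if there exists u ∈ F with u ≠ 0 and det G_b = u²·det M. -/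
open Matrix

namespace Matrix

variable {F m : Type*} [Field F] [Fintype m]

/-- `A` represents `B` if `B = Pᵀ A P` for some square matrix `P`. -/
def FormRepresents (A B : Matrix m m F) : Prop :=
  ∃ P : Matrix m m F, Pᵀ * A * P = B

theorem FormRepresents.trans {A B C : Matrix m m F} (h₁ : A.FormRepresents B)
    (h₂ : B.FormRepresents C) : A.FormRepresents C := by
  obtain ⟨P, rfl⟩ := h₁
  obtain ⟨Q, rfl⟩ := h₂
  exact ⟨P * Q, by simp only [transpose_mul, Matrix.mul_assoc]⟩

variable [DecidableEq m]

theorem FormRepresents.refl (A : Matrix m m F) : A.FormRepresents A :=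
  ⟨1, by simp⟩

theorem FormRepresents.exists_det_eq {A B : Matrix m m F} (h : A.FormRepresents B) :
    ∃ s : F, B.det = s ^ 2 * A.det := by
  obtain ⟨P, rfl⟩ := h
  exact ⟨P.det, by rw [det_mul, det_mul, det_transpose]; ring⟩

theorem FormRepresents.symm {A B : Matrix m m F} (h : A.FormRepresents B) (hB : B.det ≠ 0) :
    B.FormRepresents A := by
  obtain ⟨P, rfl⟩ := h
  have hP : IsUnit P.det := by
    rw [isUnit_iff_ne_zero]
    rintro h
    simp [h] at hB
  refine ⟨P⁻¹, ?_⟩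
  have h₁ : P⁻¹ᵀ * Pᵀ = 1 := by rw [← transpose_mul, mul_nonsing_inv _ hP, transpose_one]
  calc P⁻¹ᵀ * (Pᵀ * A * P) * P⁻¹ = (P⁻¹ᵀ * Pᵀ) * A * (P * P⁻¹) := by
        simp only [Matrix.mul_assoc]
    _ = A := by rw [h₁, mul_nonsing_inv _ hP, Matrix.one_mul, Matrix.mul_one]

theorem exists_formRepresents_diagonal {d : ℕ} (h2 : (2 : F) ≠ 0) {A : Matrix (Fin d) (Fin d) F}
    (hA : Aᵀ = A) (hA0 : A.det ≠ 0) :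
    ∃ w : Fin d → F, (∀ k, w k ≠ 0) ∧ A.FormRepresents (diagonal w) := by
  have : Invertible (2 : F) := invertibleOfNonzero h2
  have hB : (Matrix.toBilin' A).IsSymm := by
    rw [LinearMap.BilinForm.isSymm_def]
    intro x y
    rw [Matrix.toBilin'_apply', Matrix.toBilin'_apply', dotProduct_mulVec, dotProduct_comm,
      ← mulVec_transpose, hA]
  obtain ⟨v, hv⟩ := LinearMap.BilinForm.exists_orthogonal_basis (LinearMap.BilinForm.isSymm_iff.mp hB)
  have hd : Module.finrank F (Fin d → F) = d := by simp
  let e : Fin d ≃ Fin (Module.finrank F (Fin d → F)) := finCongr hd.symm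
  let P : Matrix (Fin d) (Fin d) F := of fun r c => v (e c) r
  have hP : P.det ≠ 0 := by
    rw [← isUnit_iff_ne_zero, ← isUnit_iff_isUnit_det, ← linearIndependent_cols_iff_isUnit]
    exact v.linearIndependent.comp e e.injective
  have key : ∀ i j, (Pᵀ * A * P) i j = Matrix.toBilin' A (v (e i)) (v (e j)) := by
    intro i j
    rw [Matrix.toBilin'_apply', Matrix.mul_assoc]
    rfl
  have hdiag : Pᵀ * A * P = diagonal fun i => Matrix.toBilin' A (v (e i)) (v (e i)) := by
    ext i j
    rw [key, diagonal_apply]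
    split_ifs with h
    · rw [h]
    · exact hv fun h' => h (e.injective h')
  refine ⟨_, fun k hk => ?_, P, hdiag⟩
  have hdet := congrArg det hdiag
  rw [det_diagonal, Finset.prod_eq_zero (Finset.mem_univ k) hk, det_mul, det_mul,
    det_transpose] at hdet
  exact mul_ne_zero (mul_ne_zero hP hA0) hP hdet

theorem formRepresents_diagonal_update {w : m → F} {i j : m} (hij : i ≠ j) {x y : F}
    (h : w i * x ^ 2 + w j * y ^ 2 = 1) :
    (diagonal w).FormRepresents
      (diagonal (Function.update (Function.update w j 1) i (w i * w j))) := by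
  refine ⟨of fun r c => if c = i then
      (Pi.single i (-(w j * y)) + Pi.single j (w i * x) : m → F) r
    else if c = j then (Pi.single i x + Pi.single j y : m → F) r else (Pi.single c 1 : m → F) r, ?_⟩
  ext a b
  rw [Matrix.mul_assoc, mul_apply]
  simp only [diagonal_mul, transpose_apply, of_apply]
  by_cases ha : a = i
  · by_cases hb : b = i
    · subst ha hb
      simp [Pi.single_apply, add_mul, mul_add, Finset.sum_add_distrib, hij, hij.symm]
      linear_combination (w b * w j) * h
    · by_cases hb' : b = j
      · subst ha hb'
        simp [Pi.single_apply, add_mul, mul_add, Finset.sum_add_distrib, hij, hij.symm]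
        ring
      · subst ha
        simp [Pi.single_apply, add_mul, hb, hb', Ne.symm hb]
  · by_cases ha' : a = j
    · by_cases hb : b = i
      · subst ha' hb
        simp [Pi.single_apply, add_mul, mul_add, Finset.sum_add_distrib, hij, hij.symm]
        ring
      · by_cases hb' : b = j
        · subst ha' hb'
          simp [Pi.single_apply, add_mul, mul_add, Finset.sum_add_distrib, hij, hij.symm]
          linear_combination h
        · subst ha'
          simp [Pi.single_apply, add_mul, hb, hb', Ne.symm hb',
            hij.symm]
    · by_cases hb : b = i
      · subst hb
        simp [Pi.single_apply, ha, ha']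
      · by_cases hb' : b = j
        · subst hb'
          simp [Pi.single_apply, ha, ha', hb]
        · simp only [Pi.single_apply, ha, ha', hb, hb', diagonal_apply, if_false]
          by_cases hab : a = b
          · subst hab
            simp [ha, ha']
          · simp [hab, Ne.symm hab]

theorem formRepresents_diagonal_update_scale (w : m → F) (i : m) (s : F) :
    (diagonal w).FormRepresents (diagonal (Function.update w i (s ^ 2 * w i))) := by
  refine ⟨diagonal (Function.update 1 i s), ?_⟩
  rw [diagonal_transpose, diagonal_mul_diagonal, diagonal_mul_diagonal]
  congr 1
  ext k
  by_cases hk : k = i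
  · subst hk
    simp
    ring
  · simp [hk]

section Finite

variable [Fintype F]

theorem exists_sq_add_sq_eq_one (h2 : ringChar F ≠ 2) {a b : F} (ha : a ≠ 0) (hb : b ≠ 0) :
    ∃ x y : F, a * x ^ 2 + b * y ^ 2 = 1 := by
  open Polynomial in
  obtain ⟨x, y, h⟩ := FiniteField.exists_root_sum_quadratic
    (f := C a * X ^ 2 + C 0 * X + C (-1)) (g := C b * X ^ 2 + C 0 * X + C 0)
    (degree_quadratic ha) (degree_quadratic hb) (FiniteField.odd_card_of_char_ne_two h2)
  refine ⟨x, y, ?_⟩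
  simp at h
  linear_combination h

theorem formRepresents_diagonal_prod (h2 : ringChar F ≠ 2) {w : m → F} (hw : ∀ k, w k ≠ 0) (i : m) :
    (diagonal w).FormRepresents (diagonal (Function.update 1 i (∏ k, w k))) := by
  have key : ∀ s : Finset m, i ∉ s → (diagonal w).FormRepresents (diagonal (Function.update
      (fun k => if k ∈ s then 1 else w k) i (w i * ∏ k ∈ s, w k))) := by
    intro s
    induction s using Finset.induction_on with
    | empty => intro _; simpa using FormRepresents.refl _
    | insert j s hj ih =>
      intro hi
      rw [Finset.mem_insert, not_or] at hi
      refine (ih hi.2).trans ?_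
      obtain ⟨x, y, h⟩ := exists_sq_add_sq_eq_one h2
        (mul_ne_zero (hw i) (Finset.prod_ne_zero_iff.mpr fun k (_ : k ∈ s) => hw k)) (hw j)
      convert formRepresents_diagonal_update hi.1 (x := x) (y := y) _ using 2
      · ext k
        by_cases hk : k = i
        · subst hk
          simp [Finset.prod_insert hj, hj, Ne.symm hi.1]
          ring
        · by_cases hk' : k = j
          · subst hk'
            simp [hk]
          · simp [hk, hk']
      · simpa [hj, Ne.symm hi.1] using h
  convert key (Finset.univ.erase i) (Finset.notMem_erase i _) using 2
  rw [Finset.mul_prod_erase _ _ (Finset.mem_univ i)]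
  ext k
  by_cases hk : k = i <;> simp [hk]

/-- Nondegenerate symmetric bilinear forms over a finite field of odd characteristic are classified
by dimension and discriminant. -/
theorem formRepresents_of_det_eq_sq_mul (h2 : ringChar F ≠ 2) {d : ℕ} {A B : Matrix (Fin d) (Fin d) F}
    (hA : Aᵀ = A) (hB : Bᵀ = B) (hA0 : A.det ≠ 0) {u : F} (hu : u ≠ 0)
    (h : B.det = u ^ 2 * A.det) : A.FormRepresents B := by
  have hB0 : B.det ≠ 0 := h ▸ mul_ne_zero (pow_ne_zero 2 hu) hA0
  have h2' : (2 : F) ≠ 0 := Ring.two_ne_zero h2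
  obtain - | d := d
  · rw [Subsingleton.elim B A]
    exact FormRepresents.refl A
  have normal : ∀ C : Matrix (Fin (d + 1)) (Fin (d + 1)) F, Cᵀ = C → C.det ≠ 0 →
      ∃ c s : F, c ≠ 0 ∧ s ≠ 0 ∧ c = s ^ 2 * C.det ∧
        C.FormRepresents (diagonal (Function.update 1 0 c)) := by
    intro C hC hC0
    obtain ⟨w, hw, hCw⟩ := exists_formRepresents_diagonal h2' hC hC0
    obtain ⟨s, hs⟩ := hCw.exists_det_eq
    rw [det_diagonal] at hs
    have hprod : ∏ k, w k ≠ 0 := Finset.prod_ne_zero_iff.mpr fun k _ => hw k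
    exact ⟨_, s, hprod, by rintro rfl; simp [hs] at hprod, hs,
      hCw.trans (formRepresents_diagonal_prod h2 hw 0)⟩
  obtain ⟨a, s, -, hs, has, hA'⟩ := normal A hA hA0
  obtain ⟨b, t, hb, -, hbt, hB'⟩ := normal B hB hB0
  refine hA'.trans (.trans ?_ (hB'.symm (by simpa [Finset.prod_update_of_mem] using hb)))
  have hab : b = (t * u / s) ^ 2 * a := by
    rw [hbt, has, h]
    field_simp
  have := formRepresents_diagonal_update_scale (Function.update (1 : Fin (d + 1) → F) 0 a) 0 (t * u / s)
  rwa [Function.update_idem, Function.update_self, ← hab] at this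

end Finite

/-- A symmetric matrix factors through its basic submatrix. -/
theorem exists_transpose_mul_submatrix_mul {m n : Type*} [Fintype m] [Fintype n] [DecidableEq n]
    {G : Matrix n n F} (hG : Gᵀ = G) {ι : m → n}
    (hspan : Submodule.span F (Set.range fun i => Gᵀ (ι i)) = LinearMap.range G.mulVecLin) :
    ∃ C : Matrix m n F, Cᵀ * G.submatrix ι ι * C = G := by
  have hcol : ∀ j, ∃ c : m → F, ∑ i, c i • Gᵀ (ι i) = Gᵀ j := by
    intro j
    rw [← Submodule.mem_span_range_iff_exists_fun, hspan]
    exact ⟨Pi.single j 1, by ext; simp⟩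
  choose c hc using hcol
  let C : Matrix m n F := of fun i j => c j i
  have h₁ : G.submatrix id ι * C = G := by
    ext k j
    have := congrFun (hc j) k
    simp only [Finset.sum_apply, Pi.smul_apply, transpose_apply, smul_eq_mul] at this
    rw [← this, mul_apply]
    exact Finset.sum_congr rfl fun i _ => mul_comm _ _
  have h₂ : Cᵀ * G.submatrix ι id = G := by
    have := congrArg transpose h₁
    rwa [transpose_mul, transpose_submatrix, hG] at this
  refine ⟨C, ?_⟩
  have h₃ : G.submatrix ι ι * C = G.submatrix ι id := by
    conv_rhs => rw [← h₁]
    rfl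
  rw [Matrix.mul_assoc, h₃, h₂]

end Matrix

/-- Case O: `F = F_q` with `q` odd.  `G` is symmetric of rank `d`, `ι` picks out `d`
columns of `G` forming a basis of the column space, and `G_b = G.submatrix ι ι` is the
corresponding basic submatrix.  Then `G` is the Gram matrix of a frame for the quadratic
space `(F^d, ⟨u,v⟩ = uᵀ M v)` iff `det G_b` and `det M` differ by a nonzero square. -/
theorem stmt_6 (q d n : ℕ) (hq : IsPrimePow q) (hodd : Odd q)
    (F : Type*) [Field F] [Fintype F] (hF : Fintype.card F = q)
    (G : Matrix (Fin n) (Fin n) F) (hGsymm : Gᵀ = G) (hGrank : G.rank = d)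
    (ι : Fin d → Fin n) (hinj : Function.Injective ι)
    (hli : LinearIndependent F (fun i : Fin d => Gᵀ (ι i)))
    (hspan : Submodule.span F (Set.range fun i : Fin d => Gᵀ (ι i)) =
      LinearMap.range G.mulVecLin)
    (M : Matrix (Fin d) (Fin d) F) (hMsymm : Mᵀ = M) (hMinv : IsUnit M.det) :
    (∃ Φ : Matrix (Fin d) (Fin n) F, Φ.rank = d ∧ Φᵀ * M * Φ = G) ↔
      ∃ u : F, u ≠ 0 ∧ (G.submatrix ι ι).det = u ^ 2 * M.det := by
  have hchar : ringChar F ≠ 2 := by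
    intro h
    have := FiniteField.even_card_of_char_two h
    rw [hF] at this
    exact absurd hodd (by rw [Nat.odd_iff]; omega)
  obtain ⟨C, hC⟩ := exists_transpose_mul_submatrix_mul hGsymm hspan
  have hbrank : (G.submatrix ι ι).rank = d := by
    refine le_antisymm ((rank_le_width _).trans_eq rfl) ?_
    calc d = (Cᵀ * G.submatrix ι ι * C).rank := by rw [hC, hGrank]
      _ ≤ (Cᵀ * G.submatrix ι ι).rank := rank_mul_le_left _ _
      _ ≤ _ := rank_mul_le_right _ _
  have hb : (G.submatrix ι ι).det ≠ 0 := by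
    rw [← isUnit_iff_ne_zero, ← isUnit_iff_isUnit_det, ← linearIndependent_cols_iff_isUnit,
      linearIndependent_iff_card_eq_finrank_span, Fintype.card_fin]
    exact hbrank.symm.trans (rank_eq_finrank_span_cols _)
  constructor
  · rintro ⟨Φ, -, hΦ⟩
    have hrep : M.FormRepresents (G.submatrix ι ι) := ⟨Φ.submatrix id ι, by rw [← hΦ]; rfl⟩
    obtain ⟨s, hs⟩ := hrep.exists_det_eq
    exact ⟨s, by rintro rfl; simp [hs] at hb, hs⟩
  · rintro ⟨u, hu, hdet⟩
    obtain ⟨P, hP⟩ := formRepresents_of_det_eq_sq_mul hchar hMsymm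
      (by rw [transpose_submatrix, hGsymm]) hMinv.ne_zero hu hdet
    have hΦ : (P * C)ᵀ * M * (P * C) = G := by
      rw [← hC, ← hP]
      simp only [transpose_mul, Matrix.mul_assoc]
    refine ⟨P * C, le_antisymm (rank_le_height _) ?_, hΦ⟩
    calc d = ((P * C)ᵀ * M * (P * C)).rank := by rw [hΦ, hGrank]
      _ ≤ _ := rank_mul_le_right _ _
end

section
/- Let q be a prime power, F a finite field with q² elements and characteristic p, let n be a positive integer dividing q+1, let ω ∈ F have multiplicative order n, and let D ⊆ ℤ/nℤ be nonempty with |D| = d. Let F_D be the d × n matrix with rows indexed by D and columns indexed by ℤ/nℤ whose (i,j) entry is ω^{ij}. Then F_D is an equiangular tight frame for the complex model on F^d — that is, rank F_D = d, F_D·(F_D)* = n·I, every diagonal entry of the Gram matrix G = (F_D)*·F_D equals the image of d in F, and there exists b ∈ F with G_{ij}·G_{ji} = b for all i ≠ j — if and only if D is a p-modular difference set. -/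
open Matrix

/-- `D ⊆ ℤ/nℤ` is a `p`-modular difference set: the number of difference representations
of each nonzero element is constant mod `p`. -/
def IsModularDifferenceSet (p n : ℕ) (D : Finset (Fin n)) : Prop :=
  ∃ lam : ZMod p, ∀ g : Fin n, g.val ≠ 0 →
    (((D ×ˢ D).filter (fun ab : Fin n × Fin n => ab.1 - ab.2 = g)).card : ZMod p) = lam

open Finset in
/-- Orthogonality of the characters `h ↦ ω ^ (a * h)` of `ℤ/nℤ`. -/
lemma IsPrimitiveRoot.sum_pow_mul_inv_pow {F : Type*} [Field F] {n : ℕ} {ω : F}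
    (hω : IsPrimitiveRoot ω n) (a b : Fin n) :
    ∑ h : Fin n, ω ^ (a.val * h.val) * ω⁻¹ ^ (b.val * h.val) = if a = b then (n : F) else 0 := by
  have hω0 : ω ≠ 0 := hω.ne_zero (Fin.pos a).ne'
  have hsum : ∑ h : Fin n, ω ^ (a.val * h.val) * ω⁻¹ ^ (b.val * h.val)
      = ∑ h ∈ range n, (ω ^ a.val * ω⁻¹ ^ b.val) ^ h := by
    rw [← Fin.sum_univ_eq_sum_range]
    exact sum_congr rfl fun h _ => by rw [mul_pow, pow_mul, pow_mul]
  rw [hsum]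
  split_ifs with hab
  · subst hab
    simp [inv_pow, hω0]
  · have hne : ω ^ a.val * ω⁻¹ ^ b.val ≠ 1 := by
      intro h
      rw [inv_pow, ← div_eq_mul_inv, div_eq_one_iff_eq (pow_ne_zero _ hω0)] at h
      exact hab (Fin.ext (hω.pow_inj a.isLt b.isLt h))
    have hpow : (ω ^ a.val * ω⁻¹ ^ b.val) ^ n = 1 := by
      rw [mul_pow, ← pow_mul, ← pow_mul, mul_comm a.val, mul_comm b.val, pow_mul, pow_mul,
        inv_pow, hω.pow_eq_one]
      simp
    rw [geom_sum_eq hne, hpow, sub_self, zero_div]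

/-- The Fourier transform of a function that is constant off `0` is constant off `0`. -/
lemma IsPrimitiveRoot.sum_mul_pow_of_const {F : Type*} [Field F] {n : ℕ} [NeZero n] {ω : F}
    (hω : IsPrimitiveRoot ω n) (N : Fin n → F) (c : F) (hN : ∀ g, g ≠ 0 → N g = c)
    (h : Fin n) (hh : h ≠ 0) :
    ∑ g : Fin n, N g * ω ^ (g.val * h.val) = N 0 - c := by
  have horth := hω.sum_pow_mul_inv_pow h 0
  simp only [Fin.val_zero, zero_mul, pow_zero, mul_one, if_neg hh] at horth
  have hsplit : ∀ g : Fin n, N g * ω ^ (g.val * h.val)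
      = c * ω ^ (h.val * g.val) + if g = 0 then N 0 - c else 0 := by
    intro g
    split_ifs with hg
    · subst hg; simp
    · rw [hN g hg, add_zero, mul_comm g.val]
  simp [hsplit, Finset.sum_add_distrib, ← Finset.mul_sum, horth]

/-- A function on `ℤ/nℤ` whose Fourier transform is constant off `0` is itself constant
off `0`. -/
lemma IsPrimitiveRoot.const_of_sum_mul_pow {F : Type*} [Field F] {n : ℕ} [NeZero n] {ω : F}
    (hω : IsPrimitiveRoot ω n) (hn : (n : F) ≠ 0) (N : Fin n → F) (b : F)
    (hN : ∀ h : Fin n, h ≠ 0 → ∑ g : Fin n, N g * ω ^ (g.val * h.val) = b)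
    (g : Fin n) (hg : g ≠ 0) :
    N g = ((∑ a, N a) - b) / n := by
  have key := hω.inv.sum_mul_pow_of_const
    (fun h => ∑ a : Fin n, N a * ω ^ (a.val * h.val)) b hN g hg
  have hinv : ∑ h : Fin n, (∑ a : Fin n, N a * ω ^ (a.val * h.val)) * ω⁻¹ ^ (h.val * g.val)
      = N g * n := by
    simp_rw [Finset.sum_mul]
    rw [Finset.sum_comm]
    have horth : ∀ a : Fin n,
        ∑ h : Fin n, N a * ω ^ (a.val * h.val) * ω⁻¹ ^ (h.val * g.val)
          = if a = g then N a * n else 0 := by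
      intro a
      simp_rw [mul_assoc, ← Finset.mul_sum, mul_comm _ g.val]
      rw [hω.sum_pow_mul_inv_pow, mul_ite, mul_zero]
    simp_rw [horth]
    simp
  rw [hinv] at key
  rw [eq_div_iff hn, key]
  simp

lemma pow_fin_sub {F : Type*} [Field F] {n : ℕ} {z : F} (hz : z ^ n = 1) (a b : Fin n) :
    z ^ (a - b).val = z ^ a.val * z⁻¹ ^ b.val := by
  have hz0 : z ≠ 0 := by
    rintro rfl
    rw [zero_pow (Fin.pos a).ne'] at hz
    exact zero_ne_one hz
  rw [Fin.sub_def, inv_pow, eq_mul_inv_iff_mul_eq₀ (pow_ne_zero _ hz0)]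
  change z ^ ((n - b.val + a.val) % n) * _ = _
  rw [← pow_eq_pow_mod _ hz, ← pow_add,
    show n - b.val + a.val + b.val = n + a.val by have := b.isLt; omega, pow_add, hz, one_mul]

/-- The number of representations of `g` as a difference of two elements of `D`. -/
def differenceCount {n : ℕ} (D : Finset (Fin n)) (g : Fin n) : ℕ :=
  ((D ×ˢ D).filter fun ab : Fin n × Fin n => ab.1 - ab.2 = g).card

lemma sum_differenceCount_mul_pow {F : Type*} [Field F] {n : ℕ} (D : Finset (Fin n)) {z : F}
    (hz : z ^ n = 1) :
    ∑ g : Fin n, (differenceCount D g : F) * z ^ g.val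
      = (∑ a ∈ D, z ^ a.val) * ∑ b ∈ D, z⁻¹ ^ b.val := by
  rw [Finset.sum_mul_sum, ← Finset.sum_product',
    ← Finset.sum_fiberwise (D ×ˢ D) (fun ab : Fin n × Fin n => ab.1 - ab.2)]
  refine Finset.sum_congr rfl fun g _ => ?_
  rw [differenceCount, ← nsmul_eq_mul, ← Finset.sum_const]
  refine Finset.sum_congr rfl fun ab hab => ?_
  rw [← (Finset.mem_filter.mp hab).2, pow_fin_sub hz]

/-- Being a `p`-modular difference set can be tested in any field of characteristic `p`. -/
lemma isModularDifferenceSet_iff {F : Type*} [Field F] {p n : ℕ} [CharP F p] [NeZero n]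
    (D : Finset (Fin n)) :
    IsModularDifferenceSet p n D ↔ ∃ c : F, ∀ g, g ≠ 0 → (differenceCount D g : F) = c := by
  constructor
  · rintro ⟨lam, hlam⟩
    refine ⟨ZMod.castHom dvd_rfl F lam, fun g hg => ?_⟩
    rw [← hlam g (Fin.val_ne_zero_iff.mpr hg), map_natCast]
    rfl
  · rintro ⟨c, hc⟩
    by_cases hex : ∃ g₀ : Fin n, g₀ ≠ 0
    · obtain ⟨g₀, hg₀⟩ := hex
      refine ⟨differenceCount D g₀, fun g hg => ZMod.castHom_injective F ?_⟩
      rw [map_natCast, map_natCast, hc g₀ hg₀]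
      exact hc g (Fin.val_ne_zero_iff.mp hg)
    · exact ⟨0, fun g hg => (hex ⟨g, Fin.val_ne_zero_iff.mp hg⟩).elim⟩

/-- With `n ∣ q+1` and `ω ∈ F` of order `n`, the harmonic matrix `F_D = (ω^{ij})_{i∈D, j}`
is an equiangular tight frame for the complex model on `F^d` iff `D` is a `p`-modular
difference set, where `p = char F`. -/
theorem stmt_13 (q p n d : ℕ) (hq : IsPrimePow q) (hn : 0 < n) (hdvd : n ∣ q + 1)
    (F : Type*) [Field F] [Fintype F] (hF : Fintype.card F = q ^ 2)
    (hp : p.Prime) (hchar : CharP F p)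
    (ω : F) (hω : orderOf ω = n)
    (D : Finset (Fin n)) (hD : D.Nonempty) (hcard : D.card = d)
    (Φ : Matrix {i // i ∈ D} (Fin n) F)
    (hΦ : ∀ i j, Φ i j = ω ^ ((i : Fin n).val * j.val)) :
    (Φ.rank = d ∧
      Φ * conjT q Φ = (n : F) • (1 : Matrix {i // i ∈ D} {i // i ∈ D} F) ∧
      (∀ j, (conjT q Φ * Φ) j j = (d : F)) ∧
      (∃ b : F, ∀ i j, i ≠ j → (conjT q Φ * Φ) i j * (conjT q Φ * Φ) j i = b)) ↔
    IsModularDifferenceSet p n D := by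
  have : NeZero n := ⟨hn.ne'⟩
  have hprim : IsPrimitiveRoot ω n := hω ▸ IsPrimitiveRoot.orderOf ω
  have hω0 : ω ≠ 0 := hprim.ne_zero hn.ne'
  have hpq : p ∣ q := by
    have : ((q ^ 2 : ℕ) : F) = 0 := by rw [← hF, FiniteField.cast_card_eq_zero]
    exact hp.dvd_of_dvd_pow ((CharP.cast_eq_zero_iff F p _).mp this)
  have hnF : (n : F) ≠ 0 := by
    rw [Ne, CharP.cast_eq_zero_iff F p]
    intro h
    exact hp.one_lt.ne' (Nat.dvd_one.mp ((Nat.dvd_add_right hpq).mp (h.trans hdvd)))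
  have hconj : ω ^ q = ω⁻¹ := by
    rw [← mul_eq_one_iff_eq_inv₀ hω0, ← pow_succ]
    exact (hprim.pow_eq_one_iff_dvd _).mpr hdvd
  have hconjpow : ∀ k, (ω ^ k) ^ q = ω⁻¹ ^ k := fun k => by rw [pow_right_comm, hconj]
  have hrow : Φ * conjT q Φ = (n : F) • (1 : Matrix {i // i ∈ D} {i // i ∈ D} F) := by
    ext a b
    simp only [Matrix.mul_apply, conjT, Matrix.of_apply, hΦ, hconjpow,
      hprim.sum_pow_mul_inv_pow, Matrix.smul_apply, Matrix.one_apply, smul_eq_mul, mul_ite,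
      mul_one, mul_zero, Subtype.ext_iff]
  have hrank : Φ.rank = d := by
    refine le_antisymm ?_ ?_
    · simpa [hcard] using Φ.rank_le_card_height
    · have hunit : IsUnit ((n : F) • (1 : Matrix {i // i ∈ D} {i // i ∈ D} F)) :=
        isUnit_one.smul (Units.mk0 _ hnF)
      have h := Matrix.rank_mul_le_left Φ (conjT q Φ)
      rw [hrow, Matrix.rank_of_isUnit _ hunit] at h
      simpa [hcard] using h
  have hgram : ∀ i j, (conjT q Φ * Φ) i j = ∑ a ∈ D, (ω ^ j.val * ω⁻¹ ^ i.val) ^ a.val := by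
    intro i j
    rw [Matrix.mul_apply, ← Finset.sum_coe_sort D]
    refine Finset.sum_congr rfl fun a _ => ?_
    rw [conjT, Matrix.of_apply, hΦ, hΦ, hconjpow, mul_pow, ← pow_mul, ← pow_mul, mul_comm,
      mul_comm i.val, mul_comm j.val]
  have hdiag : ∀ j, (conjT q Φ * Φ) j j = (d : F) := by
    intro j
    rw [hgram, ← hcard]
    simp [inv_pow, hω0]
  have hprod : ∀ i j, (conjT q Φ * Φ) i j * (conjT q Φ * Φ) j i
      = ∑ g : Fin n, (differenceCount D g : F) * ω ^ (g.val * (j - i).val) := by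
    intro i j
    have hz := pow_fin_sub hprim.pow_eq_one j i
    have hzn : (ω ^ (j - i).val) ^ n = 1 := by
      rw [pow_right_comm, hprim.pow_eq_one, one_pow]
    have hinv : ω ^ i.val * ω⁻¹ ^ j.val = (ω ^ (j - i).val)⁻¹ := by
      rw [hz, mul_inv, inv_pow, inv_pow, inv_inv, mul_comm]
    rw [hgram, hgram, hinv, ← hz, ← sum_differenceCount_mul_pow D hzn]
    exact Finset.sum_congr rfl fun g _ => by rw [← pow_mul, mul_comm g.val]
  rw [isModularDifferenceSet_iff (F := F)]
  constructor
  · rintro ⟨-, -, -, b, hb⟩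
    refine ⟨_, hprim.const_of_sum_mul_pow hnF (fun g => (differenceCount D g : F)) b
      fun h hh => ?_⟩
    rw [← hb 0 h hh.symm, hprod, sub_zero]
  · rintro ⟨c, hc⟩
    refine ⟨hrank, hrow, hdiag, differenceCount D 0 - c, fun i j hij => ?_⟩
    rw [hprod]
    exact hprim.sum_mul_pow_of_const (fun g => (differenceCount D g : F)) c hc _
      (sub_ne_zero.mpr hij.symm)
end

section
/- Let q be a prime power, F a finite field with q² elements, m ≥ 1, and let d_1, …, d_m ≥ 2 be integers each dividing q+1; let ω_1, …, ω_m ∈ F with ω_k of multiplicative order d_k: set G = ∏_k ℤ/d_kℤ and D = ∏_k d_k. Then for every nonzero φ : G → F with a = ⟨φ, φ⟩, the D² vectors {T_x M_y φ : x, y ∈ G} span the space F^G of functions G → F, each satisfies ⟨T_x M_y φ, T_x M_y φ⟩ = a, and ∑_{x,y ∈ G} ⟨T_x M_y φ, v⟩·(T_x M_y φ) = D·a·v for every v ∈ F^G; that is, the Gabor system {T_x M_y φ} is an (a, D·a)-equal-norm tight frame for F^G. -/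
open Finset

/-- Sum of the powers of a `d`-th root of unity. -/
theorem sum_fin_pow_of_pow_eq_one {F : Type*} [Field F] [DecidableEq F] {d : ℕ} {ζ : F}
    (hζ : ζ ^ d = 1) :
    ∑ j : Fin d, ζ ^ (j : ℕ) = if ζ = 1 then (d : F) else 0 := by
  rw [Fin.sum_univ_eq_sum_range (fun j => ζ ^ j)]
  split_ifs with h
  · simp [h]
  · rw [geom_sum_eq h, hζ, sub_self, zero_div]

/-- If `ω` has order `d ∣ q + 1`, then `x ↦ x ^ q` inverts the powers of `ω`. -/
theorem pow_mul_pow_eq_one_iff {F : Type*} [Field F] {q d : ℕ} {ω : F} (hω : orderOf ω = d)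
    (hd : d ∣ q + 1) (s t : Fin d) :
    (ω ^ (s : ℕ)) ^ q * ω ^ (t : ℕ) = 1 ↔ s = t := by
  have hunit : (ω ^ (s : ℕ)) ^ q * ω ^ (s : ℕ) = 1 := by
    have hq : ω ^ (q + 1) = 1 := orderOf_dvd_iff_pow_eq_one.mp (hω ▸ hd)
    rw [← pow_succ, ← pow_mul, mul_comm, pow_mul, hq, one_pow]
  refine ⟨fun h => ?_, fun h => h ▸ hunit⟩
  have hne : (ω ^ (s : ℕ)) ^ q ≠ 0 := left_ne_zero_of_mul_eq_one h
  exact Fin.ext (pow_injOn_Iio_orderOf (by simp [hω]) (by simp [hω])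
    (mul_left_cancel₀ hne (hunit.trans h.symm)))

/-- The characters of `∏ k, ℤ/d_kℤ` are unimodular for the conjugation `x ↦ x ^ q`. -/
theorem char_pow_mul_self {F ι : Type*} [Field F] [Fintype ι] {q : ℕ} {d : ι → ℕ} {ω : ι → F}
    (hd : ∀ k, d k ∣ q + 1) (hω : ∀ k, orderOf (ω k) = d k) (e : ι → ℕ) :
    (∏ k, ω k ^ e k) ^ q * ∏ k, ω k ^ e k = 1 := by
  rw [← pow_succ, ← prod_pow]
  refine prod_eq_one fun k _ => ?_
  have hq : ω k ^ (q + 1) = 1 := orderOf_dvd_iff_pow_eq_one.mp (hω k ▸ hd k)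
  rw [← pow_mul, mul_comm, pow_mul, hq, one_pow]

/-- Orthogonality relations for the characters of `∏ k, ℤ/d_kℤ`. -/
theorem sum_char_pow_mul_char {F ι : Type*} [Field F] [Fintype ι] [DecidableEq ι] {q : ℕ}
    {d : ι → ℕ} {ω : ι → F} (hd : ∀ k, d k ∣ q + 1) (hω : ∀ k, orderOf (ω k) = d k)
    (s t : ∀ k, Fin (d k)) :
    ∑ y : ∀ k, Fin (d k), (∏ k, ω k ^ ((y k).val * (s k).val)) ^ q *
        ∏ k, ω k ^ ((y k).val * (t k).val) =
      if s = t then ((∏ k, d k : ℕ) : F) else 0 := by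
  classical
  have hterm : ∀ y : ∀ k, Fin (d k), (∏ k, ω k ^ ((y k).val * (s k).val)) ^ q *
        ∏ k, ω k ^ ((y k).val * (t k).val) =
      ∏ k, ((ω k ^ (s k).val) ^ q * ω k ^ (t k).val) ^ (y k).val := fun y => by
    rw [← prod_pow, ← prod_mul_distrib]
    exact prod_congr rfl fun k _ => by ring
  have hfactor : ∀ k, ∑ j : Fin (d k), ((ω k ^ (s k).val) ^ q * ω k ^ (t k).val) ^ (j : ℕ) =
      if s k = t k then (d k : F) else 0 := fun k => by
    have hk : ω k ^ d k = 1 := by rw [← hω k]; exact pow_orderOf_eq_one _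
    rw [sum_fin_pow_of_pow_eq_one]
    · simp only [pow_mul_pow_eq_one_iff (hω k) (hd k)]
    · calc ((ω k ^ (s k).val) ^ q * ω k ^ (t k).val) ^ d k
          = ((ω k ^ d k) ^ (s k).val) ^ q * (ω k ^ d k) ^ (t k).val := by ring
        _ = 1 := by simp [hk]
  simp only [hterm]
  rw [← Fintype.piFinset_univ, ← prod_univ_sum (fun _ => univ)
    (fun k (j : Fin (d k)) => ((ω k ^ (s k).val) ^ q * ω k ^ (t k).val) ^ (j : ℕ))]
  simp only [hfactor]
  split_ifs with h
  · simp [h]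
  · obtain ⟨k, hk⟩ := Function.ne_iff.mp h
    exact prod_eq_zero (mem_univ k) (if_neg hk)

/-- A divisor of `q + 1` is nonzero in a field with `q ^ 2` elements. -/
theorem natCast_ne_zero_of_dvd_succ {F : Type*} [Field F] [Fintype F] {q n : ℕ}
    (hF : Fintype.card F = q ^ 2) (hn : n ∣ q + 1) : (n : F) ≠ 0 := by
  have hq : (q : F) = 0 := by
    have h := Nat.cast_card_eq_zero F
    rw [hF, Nat.cast_pow] at h
    exact pow_eq_zero_iff two_ne_zero |>.mp h
  obtain ⟨c, hc⟩ := hn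
  intro h
  have := congrArg (Nat.cast : ℕ → F) hc
  simp [hq, h] at this

/-- Gabor frames over finite fields: for any nonzero fiducial vector `φ : G → F`, where
`G = ∏ k ℤ/d_kℤ` with each `d_k ∣ q+1`, the translates-modulates
`(T_x M_y φ)(z) = ŷ(z-x) φ(z-x)` form an `(a, D·a)`-equal-norm tight frame for `F^G`,
where `a = ⟨φ, φ⟩` and `D = ∏ k d_k`. -/
theorem stmt_14 (q m : ℕ) (hq : IsPrimePow q) (hm : 1 ≤ m)
    (F : Type*) [Field F] [Fintype F] (hF : Fintype.card F = q ^ 2)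
    (d : Fin m → ℕ) (hd : ∀ k, 2 ≤ d k) (hdvd : ∀ k, d k ∣ q + 1)
    (ω : Fin m → F) (hω : ∀ k, orderOf (ω k) = d k)
    (φ : (∀ k, Fin (d k)) → F) (hφ : φ ≠ 0) (a : F)
    (ha : a = ∑ z, (φ z) ^ q * φ z)
    (ψ : (∀ k, Fin (d k)) → (∀ k, Fin (d k)) → (∀ k, Fin (d k)) → F)
    (hψ : ∀ x y z, ψ x y z =
      (∏ k, (ω k) ^ ((y k).val * (z k - x k).val)) * φ (fun k => z k - x k)) :
    Submodule.span F
        (Set.range fun p : (∀ k, Fin (d k)) × (∀ k, Fin (d k)) => ψ p.1 p.2) = ⊤ ∧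
      (∀ x y, ∑ z, (ψ x y z) ^ q * ψ x y z = a) ∧
      (∀ v : (∀ k, Fin (d k)) → F,
        ∑ x, ∑ y, (∑ z, (ψ x y z) ^ q * v z) • ψ x y =
          (((∏ k, d k : ℕ) : F) * a) • v) := by
  have : ∀ k, NeZero (d k) := fun k => ⟨by have := hd k; omega⟩
  have hD : ((∏ k, d k : ℕ) : F) ≠ 0 := by
    rw [Nat.cast_prod]
    exact prod_ne_zero_iff.mpr fun k _ => natCast_ne_zero_of_dvd_succ hF (hdvd k)
  have hψ' : ∀ x y z, ψ x y z = (∏ k, ω k ^ ((y k).val * ((z - x) k).val)) * φ (z - x) := hψ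
  refine ⟨?_, fun x y => ?_, fun v => ?_⟩
  · obtain ⟨w, hw⟩ := Function.ne_iff.mp hφ
    have hw : φ w ≠ 0 := hw
    rw [eq_top_iff, ← (Pi.basisFun F (∀ k, Fin (d k))).span_eq, Submodule.span_le]
    rintro _ ⟨u, rfl⟩
    have hsum : ∑ y : ∀ k, Fin (d k),
        (∏ k, ω k ^ ((y k).val * (w k).val)) ^ q • ψ (u - w) y =
          (((∏ k, d k : ℕ) : F) * φ w) • Pi.basisFun F (∀ k, Fin (d k)) u := by
      ext z
      simp only [Finset.sum_apply, Pi.smul_apply, smul_eq_mul, hψ', ← mul_assoc, ← sum_mul,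
        sum_char_pow_mul_char hdvd hω, Pi.basisFun_apply, Pi.single_apply]
      by_cases hz : z = u
      · simp [hz]
      · have : w ≠ z - (u - w) := fun h => hz (by
          rw [sub_sub_eq_add_sub, eq_sub_iff_add_eq, add_comm w] at h
          exact (add_right_cancel h).symm)
        simp [hz, this]
    rw [SetLike.mem_coe, ← Submodule.smul_mem_iff _ (mul_ne_zero hD hw), ← hsum]
    exact Submodule.sum_mem _ fun y _ =>
      Submodule.smul_mem _ _ (Submodule.subset_span ⟨(u - w, y), rfl⟩)
  · rw [ha, ← Equiv.sum_comp (Equiv.subRight x) fun z => φ z ^ q * φ z]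
    refine sum_congr rfl fun z _ => ?_
    rw [hψ', mul_pow, mul_mul_mul_comm, char_pow_mul_self hdvd hω, one_mul, Equiv.subRight_apply]
  · ext w
    have hinner : ∀ x, ∑ y, (∑ z, ψ x y z ^ q * v z) * ψ x y w =
        ((∏ k, d k : ℕ) : F) * v w * (φ (w - x) ^ q * φ (w - x)) := fun x => by
      simp only [sum_mul]
      rw [sum_comm, sum_eq_single w]
      · calc _ = (∑ y : ∀ k, Fin (d k), (∏ k, ω k ^ ((y k).val * ((w - x) k).val)) ^ q *
                ∏ k, ω k ^ ((y k).val * ((w - x) k).val)) *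
                (v w * (φ (w - x) ^ q * φ (w - x))) := by
              rw [sum_mul]
              exact sum_congr rfl fun y _ => by rw [hψ']; ring
          _ = _ := by rw [sum_char_pow_mul_char hdvd hω, if_pos rfl, mul_assoc]
      · intro z _ hz
        calc _ = (∑ y : ∀ k, Fin (d k), (∏ k, ω k ^ ((y k).val * ((z - x) k).val)) ^ q *
                ∏ k, ω k ^ ((y k).val * ((w - x) k).val)) *
                (v z * (φ (z - x) ^ q * φ (w - x))) := by
              rw [sum_mul]
              exact sum_congr rfl fun y _ => by rw [hψ', hψ']; ring
          _ = 0 := by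
              rw [sum_char_pow_mul_char hdvd hω, if_neg fun h => hz (sub_left_injective h),
                zero_mul]
      · simp
    simp only [Finset.sum_apply, Pi.smul_apply, smul_eq_mul, hinner, ← mul_sum]
    rw [ha, ← Equiv.sum_comp (Equiv.subLeft w) fun z => φ z ^ q * φ z]
    simp only [Equiv.subLeft_apply]
    ring
end

section
/- Let F be a finite field with 9 elements, ζ a generator of the multiplicative group F^×, m an odd positive integer, G = (ℤ/2ℤ)^m, and d = 2^m. Define φ : G → F by φ(0) = −1 − ζ² and φ(x) = 1 for x ≠ 0, and for x, y ∈ G define ψ_{x,y} : G → F by ψ_{x,y}(z) = (−1)^{∑_k (z_k − x_k)·y_k}·φ(z − x), the exponent computed from representatives in {0,1}. Then the d² = 4^m vectors {ψ_{x,y} : x, y ∈ G} form a (0,1,0)-equiangular tight frame for F^G: (i) they span F^G; (ii) ⟨ψ_{x,y}, ψ_{x,y}⟩ = 0 for all x, y; (iii) for all (x,y) ≠ (s,t), ⟨ψ_{x,y}, ψ_{s,t}⟩·(⟨ψ_{x,y}, ψ_{s,t}⟩)³ = 1; and (iv) ∑_{x,y∈G} ⟨ψ_{x,y}, v⟩·ψ_{x,y}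 = 0 for every v ∈ F^G. In particular, Gerzon's bound n = d² is attained by n = 4^m equiangular lines in the unitary geometry of dimension d = 2^m over the field with 9 elements. -/
/-- The bicharacter `(u, w) ↦ (-1) ^ (u ⬝ w)` of `(ℤ/2ℤ)^m` with values in `R`. -/
def signChar (R : Type*) [CommRing R] {m : ℕ} (u w : Fin m → ZMod 2) : R :=
  (-1) ^ (∑ k, (u k).val * (w k).val)

namespace signChar

variable {R : Type*} [CommRing R] {m : ℕ} (u v w : Fin m → ZMod 2)

theorem eq_prod : signChar R u w = ∏ k, (-1 : R) ^ ((u k).val * (w k).val) := by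
  rw [signChar, Finset.prod_pow_eq_pow_sum]

theorem comm : signChar R u w = signChar R w u := by
  simp only [signChar, mul_comm]

theorem sub_left : signChar R (u - v) w = signChar R u w * signChar R v w := by
  simp only [eq_prod, ← Finset.prod_mul_distrib]
  refine Finset.prod_congr rfl fun k _ => ?_
  have h : ∀ a b c : ZMod 2,
      Even (((a - b).val * c.val) + (a.val * c.val + b.val * c.val)) := by decide
  rw [← pow_add, Pi.sub_apply]
  obtain ⟨n, hn⟩ := h (u k) (v k) (w k)
  have h2 := (neg_one_pow_eq_pow_mod_two (R := R) ((u k - v k).val * (w k).val))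
  have h3 := (neg_one_pow_eq_pow_mod_two (R := R) ((u k).val * (w k).val + (v k).val * (w k).val))
  rw [h2, h3]
  congr 1
  lia

theorem sub_right : signChar R u (v - w) = signChar R u v * signChar R u w := by
  rw [comm, sub_left, comm v, comm w]

theorem eq_one_or_neg_one : signChar R u w = 1 ∨ signChar R u w = -1 :=
  neg_one_pow_eq_or R _

theorem mul_self : signChar R u w * signChar R u w = 1 := by
  rcases eq_one_or_neg_one (R := R) u w with h | h <;> simp [h]

theorem pow_three : signChar R u w ^ 3 = signChar R u w := by
  rw [pow_succ, sq, mul_self, one_mul]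

theorem zero_right : signChar R u 0 = 1 := by
  simp [signChar]

theorem sum_right : ∑ w, signChar R u w = if u = 0 then 2 ^ m else 0 := by
  have hfac : ∑ w, signChar R u w = ∏ k, ∑ j : ZMod 2, (-1 : R) ^ ((u k).val * j.val) := by
    simp only [eq_prod, Fintype.prod_sum]
  have hcoord (a : ZMod 2) :
      ∑ j : ZMod 2, (-1 : R) ^ (a.val * j.val) = if a = 0 then 2 else 0 := by
    have hsum (f : ZMod 2 → R) : ∑ j, f j = f 0 + f 1 := Fin.sum_univ_two f
    have ha : ∀ a : ZMod 2, a = 0 ∨ a = 1 := by decide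
    rcases ha a with rfl | rfl
    · simp [hsum, one_add_one_eq_two]
    · simp [hsum, ZMod.val_one]
  rw [hfac]
  simp only [hcoord]
  split_ifs with hu
  · simp [hu]
  · obtain ⟨k, hk⟩ := Function.ne_iff.mp hu
    exact Finset.prod_eq_zero (Finset.mem_univ k) (if_neg hk)

theorem sum_left : ∑ u, signChar R u w = if w = 0 then 2 ^ m else 0 := by
  simp only [comm _ w, sum_right]

end signChar

/-- Inner products between translates and modulates of `1 + c δ₀` and `1 + b δ₀`. -/
theorem sum_signChar_mul_one_add_delta {R : Type*} [CommRing R] {m : ℕ} (b c : R)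
    (x y s t : Fin m → ZMod 2) :
    ∑ z, (signChar R (z - x) y * (1 + if z - x = 0 then b else 0)) *
        (signChar R (z - s) t * (1 + if z - s = 0 then c else 0)) =
      signChar R x y * signChar R s t *
        ((if y - t = 0 then 2 ^ m else 0) + b * signChar R x (y - t) +
          c * signChar R s (y - t) + if x = s then b * c * signChar R x (y - t) else 0) := by
  have hterm (z : Fin m → ZMod 2) :
      (signChar R (z - x) y * (1 + if z - x = 0 then b else 0)) *
        (signChar R (z - s) t * (1 + if z - s = 0 then c else 0)) =
      signChar R x y * signChar R s t *
        (signChar R z (y - t) + (if z = x then b * signChar R z (y - t) else 0) +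
          (if z = s then c * signChar R z (y - t) else 0) +
          if z = x then if x = s then b * c * signChar R z (y - t) else 0 else 0) := by
    simp only [signChar.sub_left, signChar.sub_right, sub_eq_zero]
    split_ifs <;> first | (exfalso; simp_all; done) | ring
  simp only [hterm, ← Finset.mul_sum, Finset.sum_add_distrib, Finset.sum_ite_eq',
    Finset.mem_univ, if_true, signChar.sum_left]


/-- Zauner-type construction over `F_9`: for `G = (ℤ/2ℤ)^m` with `m` odd, `d = 2^m`, the
Gabor system generated by the fiducial vector `φ` with `φ(0) = -1 - ζ²`, `φ(x) = 1`
otherwise, is a `(0,1,0)`-equiangular tight frame of `d² = 4^m` vectors for `F^G`; in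
particular Gerzon's bound is attained in dimension `d = 2^m` over the field with 9
elements. -/
theorem stmt_15 (F : Type*) [Field F] [Fintype F] (hF : Fintype.card F = 9)
    (ζ : F) (hζ : orderOf ζ = 8)
    (m : ℕ) (hm : Odd m)
    (φ : (Fin m → ZMod 2) → F)
    (hφ0 : φ 0 = -1 - ζ ^ 2)
    (hφ1 : ∀ x : Fin m → ZMod 2, x ≠ 0 → φ x = 1)
    (ψ : (Fin m → ZMod 2) → (Fin m → ZMod 2) → (Fin m → ZMod 2) → F)
    (hψ : ∀ x y z, ψ x y z =
      (-1 : F) ^ (∑ k, (z k - x k).val * (y k).val) * φ (fun k => z k - x k)) :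
    Submodule.span F
        (Set.range fun p : (Fin m → ZMod 2) × (Fin m → ZMod 2) => ψ p.1 p.2) = ⊤ ∧
      (∀ x y, ∑ z, (ψ x y z) ^ 3 * ψ x y z = 0) ∧
      (∀ x y s t, (x, y) ≠ (s, t) →
        (∑ z, (ψ x y z) ^ 3 * ψ s t z) * (∑ z, (ψ x y z) ^ 3 * ψ s t z) ^ 3 = 1) ∧
      (∀ v : (Fin m → ZMod 2) → F,
        ∑ x, ∑ y, (∑ z, (ψ x y z) ^ 3 * v z) • ψ x y = 0) := by
  classical
  have h3 : (3 : F) = 0 := by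
    have h9 : ((Fintype.card F : ℕ) : F) = 0 := Nat.cast_card_eq_zero F
    rw [hF] at h9
    have : (3 : F) ^ 2 = 0 := by linear_combination h9
    exact pow_eq_zero_iff two_ne_zero |>.mp this
  have hi : (ζ ^ 2) ^ 2 = -1 := by
    have h8 : ζ ^ 8 = 1 := hζ ▸ pow_orderOf_eq_one ζ
    have h4 : ζ ^ 4 ≠ 1 := pow_ne_one_of_lt_orderOf (by norm_num) (by omega)
    have : (ζ ^ 4 - 1) * (ζ ^ 4 + 1) = 0 := by linear_combination h8
    rcases mul_eq_zero.mp this with h | h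
    · exact absurd (sub_eq_zero.mp h) h4
    · linear_combination h
  generalize ζ ^ 2 = i at hφ0 hi
  have hd : (2 : F) ^ m = -1 := by
    rw [show (2 : F) = -1 by linear_combination h3, hm.neg_one_pow]
  have hφ (z : Fin m → ZMod 2) : φ z = 1 + if z = 0 then 1 - i else 0 := by
    split_ifs with hz
    · rw [hz, hφ0]; linear_combination -h3
    · rw [hφ1 z hz, add_zero]
  have hφ3 (z : Fin m → ZMod 2) : φ z ^ 3 = 1 + if z = 0 then 1 + i else 0 := by
    split_ifs with hz
    · rw [hz, hφ0]; linear_combination (-3 - i) * hi - i * h3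
    · rw [hφ1 z hz]; ring
  have hφne (z : Fin m → ZMod 2) : φ z ≠ 0 := by
    intro h
    by_cases hz : z = 0
    · rw [hz, hφ0] at h
      exact one_ne_zero (α := F) (by linear_combination (1 - i) * h - hi + h3)
    · exact one_ne_zero ((hφ1 z hz).symm.trans h)
  have hψ' (x y z : Fin m → ZMod 2) : ψ x y z = signChar F (z - x) y * φ (z - x) := hψ x y z
  have hinner (x y s t : Fin m → ZMod 2) :
      ∑ z, ψ x y z ^ 3 * ψ s t z = signChar F x y * signChar F s t *
        ((if y - t = 0 then -1 else 0) + (1 + i) * signChar F x (y - t) +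
          (1 - i) * signChar F s (y - t) +
          if x = s then (1 + i) * (1 - i) * signChar F x (y - t) else 0) := by
    rw [← hd, ← sum_signChar_mul_one_add_delta]
    refine Finset.sum_congr rfl fun z _ => ?_
    rw [hψ', hψ', mul_pow, signChar.pow_three, hφ3, hφ (z - s)]
  have hself (x y : Fin m → ZMod 2) : ∑ z, ψ x y z ^ 3 * ψ x y z = 0 := by
    rw [hinner, signChar.mul_self]
    simp only [sub_self, signChar.zero_right, if_true]
    linear_combination h3 - hi
  refine ⟨?_, hself, ?_, ?_⟩
  · rw [eq_top_iff, ← (Pi.basisFun F (Fin m → ZMod 2)).span_eq, Submodule.span_le]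
    rintro _ ⟨w, rfl⟩
    have hw : Pi.basisFun F (Fin m → ZMod 2) w =
        (-(φ w)⁻¹) • ∑ y, signChar F w y • ψ 0 y := by
      funext z
      simp only [Pi.basisFun_apply, Pi.smul_apply, Finset.sum_apply, smul_eq_mul, hψ',
        sub_zero, ← mul_assoc, ← signChar.sub_left, ← Finset.sum_mul, signChar.sum_right,
        sub_eq_zero, hd, Pi.single_apply]
      by_cases h : z = w
      · subst h
        simp [hφne]
      · simp [h, Ne.symm h]
    rw [hw]
    exact Submodule.smul_mem _ _ (Submodule.sum_mem _ fun y _ =>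
      Submodule.smul_mem _ _ (Submodule.subset_span ⟨(0, y), rfl⟩))
  · intro x y s t hne
    rw [hinner]
    by_cases hyt : y = t
    · have hxs : x ≠ s := fun h => hne (by rw [h, hyt])
      simp only [hyt, sub_self, signChar.zero_right, if_true, if_neg hxs]
      rcases signChar.eq_one_or_neg_one (R := F) x t with h | h <;>
        rcases signChar.eq_one_or_neg_one (R := F) s t with h' | h' <;> rw [h, h'] <;> ring
    · simp only [sub_eq_zero, if_neg hyt]
      have h1 := signChar.eq_one_or_neg_one (R := F) x y
      have h2 := signChar.eq_one_or_neg_one (R := F) s t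
      have h4 := signChar.eq_one_or_neg_one (R := F) x (y - t)
      have h5 := signChar.eq_one_or_neg_one (R := F) s (y - t)
      generalize signChar F x y = p at *
      generalize signChar F s t = q at *
      by_cases hxs : x = s
      · subst hxs
        generalize signChar F x (y - t) = r at *
        simp only [if_true]
        rcases h1 with rfl | rfl <;> rcases h2 with rfl | rfl <;> rcases h4 with rfl | rfl <;>
          grind
      · generalize signChar F x (y - t) = r at *
        generalize signChar F s (y - t) = r' at *
        simp only [if_neg hxs]
        rcases h1 with rfl | rfl <;> rcases h2 with rfl | rfl <;> rcases h4 with rfl | rfl <;>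
          rcases h5 with rfl | rfl <;> grind
  · have hkernel (z w : Fin m → ZMod 2) : ∑ x, ∑ y, ψ x y z ^ 3 * ψ x y w = 0 := by
      have hterm (x : Fin m → ZMod 2) : ∑ y, ψ x y z ^ 3 * ψ x y w =
          (if z = w then 2 ^ m else 0) * (φ (z - x) ^ 3 * φ (w - x)) := by
        simp only [← sub_eq_zero (a := z) (b := w)]
        rw [← signChar.sum_right, Finset.sum_mul]
        refine Finset.sum_congr rfl fun y _ => ?_
        rw [hψ', hψ', mul_pow, signChar.pow_three, ← sub_sub_sub_cancel_right z w x,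
          signChar.sub_left (z - x)]
        ring
      simp only [hterm, ← Finset.mul_sum]
      split_ifs with h
      · subst h
        have h0 := hself 0 0
        simp only [hψ', signChar.zero_right, sub_zero, one_mul] at h0
        have hshift := (Equiv.subLeft z).sum_comp fun x => φ x ^ 3 * φ x
        simp only [Equiv.subLeft_apply] at hshift
        rw [hshift, h0, mul_zero]
      · exact zero_mul _
    intro v
    funext w
    simp only [Finset.sum_apply, Pi.smul_apply, smul_eq_mul, Finset.sum_mul, Pi.zero_apply]
    calc ∑ x, ∑ y, ∑ z, ψ x y z ^ 3 * v z * ψ x y w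
        = ∑ z, v z * ∑ x, ∑ y, ψ x y z ^ 3 * ψ x y w := by
          simp only [Finset.mul_sum]
          rw [Finset.sum_comm_cycle]
          refine Finset.sum_congr rfl fun z _ => ?_
          exact Finset.sum_congr rfl fun x _ => Finset.sum_congr rfl fun y _ => by ring
      _ = 0 := by simp only [hkernel, mul_zero, Finset.sum_const_zero]
end

section
/- Let E be a subfield of ℂ that is a finite Galois extension of ℚ (hence closed under complex conjugation), let 𝓞_E be its ring of algebraic integers, and let z_1, …, z_n be nonzero elements of 𝓞_E. Then there are infinitely many nonzero prime ideals 𝔭 of 𝓞_E such that 𝔭 is closed under complex conjugation and z_i ∉ 𝔭 for every i ∈ {1,…,n}; moreover, the set of field characteristics char(𝓞_E/𝔭), as 𝔭 ranges over all such prime ideals, is infinite. -/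
open Filter Topology IsDedekindDomain NumberField
open scoped ENNReal Pointwise

/-- The sum over all finite multisets of the product of the weights: the formal expansion of the
Euler product `∏ i, (1 - w i)⁻¹`. -/
noncomputable def eulerSum {ι : Type*} (w : ι → ℝ≥0∞) : ℝ≥0∞ :=
  ∑' m : Multiset ι, (m.map w).prod

theorem eulerSum_comp_le {ι κ : Type*} {e : ι → κ} (he : e.Injective) (w : κ → ℝ≥0∞) :
    eulerSum (w ∘ e) ≤ eulerSum w := by
  have h := ENNReal.tsum_comp_le_tsum_of_injective (Multiset.map_injective he)
    fun m : Multiset κ ↦ (m.map w).prod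
  simpa [eulerSum, Multiset.map_map] using h

theorem eulerSum_comp_equiv {ι κ : Type*} (e : ι ≃ κ) (w : κ → ℝ≥0∞) :
    eulerSum (w ∘ e) = eulerSum w := by
  refine (eulerSum_comp_le e.injective w).antisymm ?_
  simpa [Function.comp_assoc] using eulerSum_comp_le e.symm.injective (w ∘ e)

theorem Multiset.filterMap_getLeft?_disjSum {α β : Type*} (s : Multiset α) (t : Multiset β) :
    (s.disjSum t).filterMap Sum.getLeft? = s := by
  simpa [disjSum, filterMap_eq_bind, bind_map] using bind_singleton s id

theorem Multiset.filterMap_getRight?_disjSum {α β : Type*} (s : Multiset α) (t : Multiset β) :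
    (s.disjSum t).filterMap Sum.getRight? = t := by
  simpa [disjSum, filterMap_eq_bind, bind_map] using bind_singleton t id

theorem Multiset.disjSum_bijective {α β : Type*} :
    Function.Bijective fun p : Multiset α × Multiset β ↦ p.1.disjSum p.2 := by
  constructor
  · rintro ⟨s, t⟩ ⟨s', t'⟩ h
    have hl := congrArg (Multiset.filterMap Sum.getLeft?) h
    have hr := congrArg (Multiset.filterMap Sum.getRight?) h
    simp only [filterMap_getLeft?_disjSum, filterMap_getRight?_disjSum] at hl hr
    rw [hl, hr]
  · intro m
    induction m using Multiset.induction with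
    | empty => exact ⟨(0, 0), by simp⟩
    | cons a m ih =>
      obtain ⟨⟨s, t⟩, rfl⟩ := ih
      cases a with
      | inl a => exact ⟨(a ::ₘ s, t), by simp [Multiset.disjSum]⟩
      | inr a => exact ⟨(s, a ::ₘ t), by simp [Multiset.disjSum]⟩

theorem eulerSum_sum {ι κ : Type*} (w : ι ⊕ κ → ℝ≥0∞) :
    eulerSum w = eulerSum (w ∘ Sum.inl) * eulerSum (w ∘ Sum.inr) := by
  rw [eulerSum, ← (Equiv.ofBijective _ Multiset.disjSum_bijective).tsum_eq, ENNReal.tsum_prod']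
  simp only [Equiv.ofBijective_apply, Multiset.map_disjSum, Multiset.prod_add,
    ENNReal.tsum_mul_left, ENNReal.tsum_mul_right]
  rfl

theorem eulerSum_punit_le {w : PUnit → ℝ≥0∞} (hw : ∀ i, w i ≤ 2⁻¹) : eulerSum w ≤ 2 := by
  have hsurj : Function.Surjective fun n : ℕ ↦ Multiset.replicate n PUnit.unit := fun m ↦
    ⟨m.card, (Multiset.eq_replicate_card.mpr fun _ _ ↦ rfl).symm⟩
  calc eulerSum w ≤ ∑' n : ℕ, ((Multiset.replicate n PUnit.unit).map w).prod :=
        ENNReal.tsum_le_tsum_comp_of_surjective hsurj _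
    _ = ∑' n : ℕ, w PUnit.unit ^ n := by simp
    _ ≤ ∑' n : ℕ, 2⁻¹ ^ n := ENNReal.tsum_le_tsum fun n ↦ by gcongr; exact hw _
    _ = 2 := by rw [ENNReal.tsum_geometric, ENNReal.one_sub_inv_two, inv_inv]

theorem eulerSum_le_two_pow {ι : Type*} [Finite ι] (w : ι → ℝ≥0∞) (hw : ∀ i, w i ≤ 2⁻¹) :
    eulerSum w ≤ 2 ^ Nat.card ι := by
  induction ι using Finite.induction_empty_option with
  | of_equiv e ih =>
    rw [← eulerSum_comp_equiv e, ← Nat.card_congr e]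
    exact ih _ fun i ↦ hw _
  | h_empty => simp [eulerSum, tsum_fintype, Subsingleton.elim _ (0 : Multiset PEmpty)]
  | @h_option α _ ih =>
    rw [← eulerSum_comp_equiv (Equiv.optionEquivSumPUnit.{0} α).symm, eulerSum_sum,
      Finite.card_option, pow_succ]
    exact mul_le_mul' (ih _ fun i ↦ hw _) (eulerSum_punit_le fun i ↦ hw _)

section Zeta

variable (K : Type*) [Field K] [NumberField K]

theorem IsDedekindDomain.HeightOneSpectrum.prod_bijective (R : Type*) [CommRing R]
    [IsDedekindDomain R] : Function.Bijective fun m : Multiset (HeightOneSpectrum R) ↦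
      (⟨(m.map HeightOneSpectrum.asIdeal).prod, Multiset.prod_ne_zero (by
        simpa using fun v _ ↦ v.ne_bot)⟩ : {I : Ideal R // I ≠ 0}) := by
  constructor
  · intro m m' h
    have hm (m : Multiset (HeightOneSpectrum R)) : UniqueFactorizationMonoid.normalizedFactors
        (m.map HeightOneSpectrum.asIdeal).prod = m.map HeightOneSpectrum.asIdeal := by
      rw [UniqueFactorizationMonoid.normalizedFactors_prod_eq]
      · simp
      · simpa using fun v _ ↦ v.irreducible
    refine Multiset.map_injective (fun _ _ ↦ HeightOneSpectrum.ext) ?_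
    exact (hm m).symm.trans <|
      (congrArg UniqueFactorizationMonoid.normalizedFactors (congrArg Subtype.val h)).trans (hm m')
  · rintro ⟨I, hI⟩
    obtain ⟨f, hf, hfI⟩ := UniqueFactorizationMonoid.exists_prime_factors I hI
    refine ⟨f.pmap (fun P hP ↦ ⟨P, Ideal.isPrime_of_prime hP, hP.ne_zero⟩) hf, ?_⟩
    simpa [Multiset.map_pmap, Multiset.pmap_eq_map] using associated_iff_eq.mp hfI

/-- The term `N(𝔭)⁻ˢ` of the prime zeta sum, as an extended nonnegative real. -/
noncomputable def primeWeight (s : ℝ) (v : HeightOneSpectrum (𝓞 K)) : ℝ≥0∞ :=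
  (Ideal.absNorm v.asIdeal : ℝ≥0∞) ^ (-s)

theorem primeWeight_le {s : ℝ} (hs : 1 ≤ s) (v : HeightOneSpectrum (𝓞 K)) :
    primeWeight K s v ≤ 2⁻¹ := by
  have h0 : Ideal.absNorm v.asIdeal ≠ 0 := by
    simpa [Ideal.absNorm_eq_zero_iff] using v.ne_bot
  have h1 : Ideal.absNorm v.asIdeal ≠ 1 := by
    simpa [Ideal.absNorm_eq_one_iff] using v.isPrime.ne_top
  have h2 : (2 : ℝ≥0∞) ≤ Ideal.absNorm v.asIdeal := by
    exact_mod_cast (by omega : 2 ≤ Ideal.absNorm v.asIdeal)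
  rw [primeWeight, ENNReal.rpow_neg, ENNReal.inv_le_inv]
  calc (2 : ℝ≥0∞) ≤ (Ideal.absNorm v.asIdeal : ℝ≥0∞) ^ (1 : ℝ) := by simpa using h2
    _ ≤ _ := ENNReal.rpow_le_rpow_of_exponent_le (le_trans (by norm_num) h2) hs

theorem prod_map_primeWeight {s : ℝ} (m : Multiset (HeightOneSpectrum (𝓞 K))) :
    (m.map (primeWeight K s)).prod =
      (Ideal.absNorm (m.map HeightOneSpectrum.asIdeal).prod : ℝ≥0∞) ^ (-s) := by
  induction m using Multiset.induction with
  | empty => simp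
  | cons v m ih =>
    simp only [Multiset.map_cons, Multiset.prod_cons, ih, map_mul, Nat.cast_mul, primeWeight]
    rw [ENNReal.mul_rpow_of_ne_top (by simp) (by simp)]

theorem term_idealCount (s : ℝ) (n : ℕ) :
    LSeries.term (fun n ↦ Nat.card {I : Ideal (𝓞 K) // Ideal.absNorm I = n}) s n =
      ((if n = 0 then 0 else
        Nat.card {I : Ideal (𝓞 K) // Ideal.absNorm I = n} * (n : ℝ) ^ (-s) : ℝ) : ℂ) := by
  split_ifs with hn
  · simp [hn]
  · rw [LSeries.term_of_ne_zero hn, div_eq_mul_inv, ← Complex.cpow_neg]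
    push_cast
    rw [Complex.ofReal_cpow (by positivity)]
    simp

theorem enorm_term (s : ℝ) (n : ℕ) :
    ‖LSeries.term (fun n ↦ Nat.card {I : Ideal (𝓞 K) // Ideal.absNorm I = n}) s n‖ₑ =
      if n = 0 then 0 else
        Nat.card {I : Ideal (𝓞 K) // Ideal.absNorm I = n} * (n : ℝ≥0∞) ^ (-s) := by
  rw [term_idealCount]
  split_ifs with hn
  · simp
  · rw [← ofReal_norm, Complex.norm_real, Real.norm_of_nonneg (by positivity),
      ENNReal.ofReal_mul (by positivity), ← ENNReal.ofReal_rpow_of_pos (by positivity)]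
    simp

theorem eulerSum_primeWeight (s : ℝ) :
    eulerSum (primeWeight K s) = ∑' n : ℕ,
      ‖LSeries.term (fun n ↦ Nat.card {I : Ideal (𝓞 K) // Ideal.absNorm I = n}) s n‖ₑ := by
  simp_rw [eulerSum, prod_map_primeWeight]
  refine ((Equiv.ofBijective _ (HeightOneSpectrum.prod_bijective (𝓞 K))).tsum_eq
    fun I : {I : Ideal (𝓞 K) // I ≠ 0} ↦ (Ideal.absNorm I.1 : ℝ≥0∞) ^ (-s)).trans ?_
  rw [← (Equiv.sigmaFiberEquiv fun I : {I : Ideal (𝓞 K) // I ≠ 0} ↦ Ideal.absNorm I.1).tsum_eq,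
    ENNReal.tsum_sigma']
  refine tsum_congr fun n ↦ ?_
  rw [enorm_term]
  split_ifs with hn
  · subst hn
    have : IsEmpty {I : {I : Ideal (𝓞 K) // I ≠ 0} // Ideal.absNorm I.1 = 0} :=
      ⟨fun I ↦ I.1.2 (Ideal.absNorm_eq_zero_iff.mp I.2)⟩
    exact tsum_empty
  · have hfin : Finite {I : Ideal (𝓞 K) // Ideal.absNorm I = n} :=
      Ideal.finite_setOfPred_absNorm_eq n
    let e : {I : {I : Ideal (𝓞 K) // I ≠ 0} // Ideal.absNorm I.1 = n} ≃
        {I : Ideal (𝓞 K) // Ideal.absNorm I = n} :=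
      { toFun := fun I ↦ ⟨I.1.1, I.2⟩
        invFun := fun I ↦ ⟨⟨I.1, fun h ↦ hn (by rw [← I.2, h]; simp)⟩, I.2⟩
        left_inv := fun _ ↦ rfl
        right_inv := fun _ ↦ rfl }
    have := Fintype.ofFinite {I : Ideal (𝓞 K) // Ideal.absNorm I = n}
    calc _ = ∑' I : {I : {I : Ideal (𝓞 K) // I ≠ 0} // Ideal.absNorm I.1 = n},
            (n : ℝ≥0∞) ^ (-s) := tsum_congr fun I ↦ by simp [Equiv.sigmaFiberEquiv, I.2]
      _ = ∑' I : {I : Ideal (𝓞 K) // Ideal.absNorm I = n}, (n : ℝ≥0∞) ^ (-s) :=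
        e.tsum_eq fun _ ↦ (n : ℝ≥0∞) ^ (-s)
      _ = _ := by simp [tsum_fintype]

theorem enorm_dedekindZeta_le (s : ℝ) :
    ‖dedekindZeta K s‖ₑ ≤ eulerSum (primeWeight K s) := by
  rw [eulerSum_primeWeight]
  exact enorm_tsum_le_tsum_enorm

theorem eulerSum_eq_enorm_dedekindZeta {s : ℝ} (hs : dedekindZeta K s ≠ 0) :
    eulerSum (primeWeight K s) = ‖dedekindZeta K s‖ₑ := by
  have hsum : LSeriesSummable
      (fun n ↦ Nat.card {I : Ideal (𝓞 K) // Ideal.absNorm I = n}) (s : ℂ) := by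
    by_contra h
    exact hs (tsum_eq_zero_of_not_summable h)
  rw [eulerSum_primeWeight, dedekindZeta, LSeries]
  rw [LSeriesSummable] at hsum
  simp_rw [funext (term_idealCount K s)] at hsum ⊢
  set a : ℕ → ℝ := fun n ↦ if n = 0 then 0 else
    Nat.card {I : Ideal (𝓞 K) // Ideal.absNorm I = n} * (n : ℝ) ^ (-s)
  have ha (n : ℕ) : 0 ≤ a n := by positivity
  rw [← Complex.ofReal_tsum, ← ofReal_norm, Complex.norm_real,
    Real.norm_of_nonneg (tsum_nonneg ha), ENNReal.ofReal_tsum_of_nonneg ha (by exact_mod_cast hsum)]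
  refine tsum_congr fun n ↦ ?_
  rw [← ofReal_norm, Complex.norm_real, Real.norm_of_nonneg (ha n)]

end Zeta

section Galois

variable {E : Type*} [Field E] [NumberField E]

/-- A prime with trivial decomposition group has residue degree one, so it has the same norm as
the prime below it. -/
theorem absNorm_under_eq {F : Type*} [Field F] [NumberField F] [Algebra F E] {G : Type*} [Group G]
    [Finite G] [MulSemiringAction G E] [IsGaloisGroup G F E] (P : HeightOneSpectrum (𝓞 E))
    (hP : MulAction.stabilizer G P.asIdeal = ⊥) :
    Ideal.absNorm (P.under (𝓞 F)).asIdeal = Ideal.absNorm P.asIdeal := by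
  have : (P.asIdeal.under (𝓞 F)).IsMaximal := (P.under (𝓞 F)).isMaximal
  have : Finite (𝓞 F ⧸ P.asIdeal.under (𝓞 F)) :=
    Ring.HasFiniteQuotients.finiteQuotient (P.under (𝓞 F)).ne_bot
  have h := Ideal.card_stabilizer_eq_card_inertia_mul_finrank (G := G) (P.asIdeal.under (𝓞 F))
    P.asIdeal
  rw [hP, Subgroup.card_bot, eq_comm, mul_eq_one] at h
  rw [← Ideal.absNorm_relNorm (𝓞 F) (𝓞 E) P.asIdeal,
    Ideal.relNorm_eq_pow_of_isMaximal P.asIdeal (P.asIdeal.under (𝓞 F)), h.2, pow_one]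
  rfl

/-- If `G` acts freely on the primes of `E` above all primes of `F` outside the finite set `S`,
then each such prime of `F` yields two primes of `E` of the same norm, exchanged by `g`. -/
theorem eulerSum_sq_le {F : Type*} [Field F] [NumberField F] [Algebra F E]
    {G : Type*} [Group G] [Finite G] [MulSemiringAction G E] [IsGaloisGroup G F E]
    (S : Set (HeightOneSpectrum (𝓞 F))) (hS : S.Finite) (g : G)
    (hstab : ∀ P : HeightOneSpectrum (𝓞 E), P.under (𝓞 F) ∉ S →
      MulAction.stabilizer G P.asIdeal = ⊥)
    (hg : ∀ P : HeightOneSpectrum (𝓞 E), P.under (𝓞 F) ∉ S → g • P.asIdeal ≠ P.asIdeal)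
    {s : ℝ} (hs : 1 ≤ s) :
    eulerSum (primeWeight F s) ^ 2 ≤ (2 ^ S.ncard) ^ 2 * eulerSum (primeWeight E s) := by
  classical
  have hsurj (p : HeightOneSpectrum (𝓞 F)) : ∃ P : HeightOneSpectrum (𝓞 E), P.under (𝓞 F) = p := by
    obtain ⟨P, hP, hPp⟩ := p.asIdeal.exists_ideal_over_prime_of_isIntegral_of_isDomain (S := 𝓞 E)
      (by simp [(RingHom.injective_iff_ker_eq_bot _).mp
        (FaithfulSMul.algebraMap_injective (𝓞 F) (𝓞 E))])
    refine ⟨⟨P, hP, ?_⟩, HeightOneSpectrum.ext hPp⟩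
    rintro rfl
    exact p.ne_bot (by simpa using hPp.symm)
  choose f hf using hsurj
  let g' (P : HeightOneSpectrum (𝓞 E)) : HeightOneSpectrum (𝓞 E) :=
    ⟨g • P.asIdeal, inferInstance, fun h ↦ P.ne_bot (by
      simpa only [inv_smul_smul, Ideal.smul_bot] using congrArg (g⁻¹ • ·) h)⟩
  have hg' (P) : (g' P).under (𝓞 F) = P.under (𝓞 F) := by
    ext1
    simp [g']
  let e : (Sᶜ : Set _) ⊕ (Sᶜ : Set _) → HeightOneSpectrum (𝓞 E) :=
    Sum.elim (fun p ↦ f p.1) (fun p ↦ g' (f p.1))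
  have hne (p : (Sᶜ : Set _)) : g' (f p) ≠ f p := fun h ↦
    hg (f p) (by rw [hf]; exact p.2) (congrArg HeightOneSpectrum.asIdeal h)
  have he : e.Injective := by
    have hu : ∀ x, (e x).under (𝓞 F) = (x.elim id id).1 := by
      rintro (x | x) <;> simp [e, hf, hg']
    rintro (x | x) (y | y) hxy <;> have hxy' := congrArg (HeightOneSpectrum.under (𝓞 F)) hxy <;>
      rw [hu, hu] at hxy' <;> obtain rfl : x = y := Subtype.ext hxy'
    · rfl
    · exact absurd hxy.symm (hne x)
    · exact absurd hxy (hne x)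
    · rfl
  have hw : primeWeight E s ∘ e =
      Sum.elim (fun p ↦ primeWeight F s p.1) (fun p ↦ primeWeight F s p.1) := by
    have key (x) : primeWeight E s (e x) = primeWeight F s ((e x).under (𝓞 F)) := by
      rw [primeWeight, primeWeight, absNorm_under_eq (G := G)]
      apply hstab
      rcases x with x | x <;> simp only [e, hf, hg', Sum.elim_inl, Sum.elim_inr] <;> exact x.2
    funext x
    rw [Function.comp_apply, key]
    rcases x with x | x <;> simp [e, hf, hg']
  have : Finite S := hS
  have h1 : eulerSum (primeWeight F s) ≤
      2 ^ S.ncard * eulerSum (fun p : (Sᶜ : Set _) ↦ primeWeight F s p.1) := by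
    rw [← eulerSum_comp_equiv (Equiv.Set.sumCompl S), eulerSum_sum]
    gcongr
    · exact eulerSum_le_two_pow _ fun _ ↦ primeWeight_le F hs _
    · rfl
  have h2 : eulerSum (fun p : (Sᶜ : Set _) ↦ primeWeight F s p.1) ^ 2 ≤
      eulerSum (primeWeight E s) := by
    refine le_trans ?_ (eulerSum_comp_le he _)
    rw [hw, eulerSum_sum, sq]
    rfl
  calc _ ≤ _ := pow_le_pow_left₀ zero_le h1 2
    _ ≤ _ := by rw [mul_pow]; gcongr

/-- The square of one zeta function has a double pole at `1`, so no other zeta function bounds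
it up to a constant. -/
theorem not_eulerSum_sq_le (F : Type*) [Field F] [NumberField F] (C : ℝ≥0∞) (hC : C ≠ ∞) :
    ¬ ∀ s : ℝ, 1 < s → eulerSum (primeWeight F s) ^ 2 ≤ C * eulerSum (primeWeight E s) := by
  intro h
  have hF := (tendsto_sub_one_mul_dedekindZeta_nhdsGT F).norm.pow 2
  have hE := tendsto_sub_one_mul_dedekindZeta_nhdsGT E
  have h0 : Tendsto (fun s : ℝ ↦ s - 1) (𝓝[>] 1) (𝓝 0) :=
    tendsto_nhdsWithin_of_tendsto_nhds <|
      Continuous.tendsto' (by fun_prop) _ _ (sub_self 1)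
  have hE' := (h0.mul hE.norm).const_mul C.toReal
  have hne : ∀ᶠ s : ℝ in 𝓝[>] 1, ((s : ℂ) - 1) * dedekindZeta E s ≠ 0 :=
    hE.eventually_ne (by simpa using dedekindZeta_residue_ne_zero E)
  have hle := le_of_tendsto_of_tendsto hF hE' (by
    filter_upwards [hne, self_mem_nhdsWithin] with s hs (hs1 : 1 < s)
    have h1 := h s hs1
    rw [eulerSum_eq_enorm_dedekindZeta E (right_ne_zero_of_mul hs)] at h1
    have h2 := (pow_le_pow_left₀ zero_le (enorm_dedekindZeta_le F s) 2).trans h1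
    have h3 := ENNReal.toReal_mono (ENNReal.mul_ne_top hC (by simp)) h2
    simp only [ENNReal.toReal_pow, ENNReal.toReal_mul, toReal_enorm] at h3
    have h4 : ‖(s : ℂ) - 1‖ = s - 1 := by
      rw [← Complex.ofReal_one, ← Complex.ofReal_sub, Complex.norm_real,
        Real.norm_of_nonneg (by linarith)]
    simp only [norm_mul, h4]
    nlinarith [mul_le_mul_of_nonneg_left h3 (sq_nonneg (s - 1))])
  have := dedekindZeta_residue_pos F
  simp at hle
  exact this.ne' hle

/-- An element of order at most two of the Galois group fixes infinitely many primes. -/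
theorem infinite_setOf_smul_eq [IsGalois ℚ E] (σ : Gal(E/ℚ)) (hσ : σ * σ = 1) :
    {P : HeightOneSpectrum (𝓞 E) | σ • P.asIdeal = P.asIdeal}.Infinite := by
  intro hfin
  let G := Subgroup.zpowers σ
  let F : IntermediateField ℚ E := FixedPoints.intermediateField G
  have : IsGaloisGroup G F E := IsGaloisGroup.subgroup Gal(E/ℚ) ℚ E G
  let S := HeightOneSpectrum.under (𝓞 F) ''
    {P : HeightOneSpectrum (𝓞 E) | σ • P.asIdeal = P.asIdeal}
  have hmoved (P : HeightOneSpectrum (𝓞 E)) (hP : P.under (𝓞 F) ∉ S) :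
      σ • P.asIdeal ≠ P.asIdeal := fun h ↦ hP ⟨P, h, rfl⟩
  refine not_eulerSum_sq_le (E := E) F ((2 ^ S.ncard) ^ 2) (by finiteness) fun s hs ↦
    eulerSum_sq_le (G := G) S (hfin.image _) ⟨σ, Subgroup.mem_zpowers σ⟩ (fun P hP ↦ ?_) hmoved hs.le
  rw [Subgroup.eq_bot_iff_forall]
  rintro ⟨x, n, rfl⟩ hx
  rcases Int.even_or_odd' n with ⟨k, rfl | rfl⟩
  · ext1
    simp [zpow_mul, sq, hσ]
  · have hk : σ ^ (2 * k + 1) = σ := by simp [zpow_add, zpow_mul, sq, hσ]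
    refine absurd ?_ (hmoved P hP)
    have hx' : σ ^ (2 * k + 1) • P.asIdeal = P.asIdeal := hx
    rwa [hk] at hx'

end Galois

theorem IsDedekindDomain.HeightOneSpectrum.finite_setOf_mem {R : Type*} [CommRing R]
    [IsDedekindDomain R] {x : R} (hx : x ≠ 0) :
    {v : HeightOneSpectrum R | x ∈ v.asIdeal}.Finite := by
  refine (Ideal.finite_factors (I := Ideal.span {x}) (by simpa using hx)).subset fun v hv ↦ ?_
  simpa [Ideal.dvd_span_singleton] using hv

theorem infinite_image_ringChar_quotient {E : Type*} [Field E] [NumberField E]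
    {S : Set (HeightOneSpectrum (𝓞 E))} (hS : S.Infinite) :
    ((fun v ↦ ringChar (𝓞 E ⧸ v.asIdeal)) '' S).Infinite := by
  intro hfin
  refine hS ((hfin.preimage' fun p hp ↦ ?_).subset (Set.subset_preimage_image _ S))
  obtain ⟨w, -, rfl⟩ := hp
  have : Finite (𝓞 E ⧸ w.asIdeal) := Ring.HasFiniteQuotients.finiteQuotient w.ne_bot
  have hne : ringChar (𝓞 E ⧸ w.asIdeal) ≠ 0 := CharP.ringChar_ne_zero_of_finite _
  refine (HeightOneSpectrum.finite_setOf_mem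
    (x := (ringChar (𝓞 E ⧸ w.asIdeal) : 𝓞 E)) (by exact_mod_cast hne)).subset fun v hv ↦ ?_
  have hv : ringChar (𝓞 E ⧸ v.asIdeal) = ringChar (𝓞 E ⧸ w.asIdeal) := hv
  rw [Set.mem_ofPred_eq, ← Ideal.Quotient.eq_zero_iff_mem, ← hv, map_natCast]
  exact ringChar.Nat.cast_ringChar

/-- Complex conjugation on a normal subfield of `ℂ`. -/
noncomputable def IntermediateField.conj (E : IntermediateField ℚ ℂ) [Normal ℚ E] : Gal(E/ℚ) :=
  (Complex.conjAe.restrictScalars ℚ).restrictNormal E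

theorem IntermediateField.coe_conj (E : IntermediateField ℚ ℂ) [Normal ℚ E] (x : E) :
    (E.conj x : ℂ) = starRingEnd ℂ x :=
  (Complex.conjAe.restrictScalars ℚ).restrictNormal_commutes E x

theorem IntermediateField.conj_mul_self (E : IntermediateField ℚ ℂ) [Normal ℚ E] :
    E.conj * E.conj = 1 := by
  ext x
  simp [coe_conj]

/-- Let `E ⊆ ℂ` be a finite Galois extension of `ℚ` with ring of integers `𝓞_E`, and let
`z_1, …, z_n` be nonzero algebraic integers in `E`.  Then there are infinitely many nonzero
prime ideals of `𝓞_E` that are closed under complex conjugation and avoid all `z_i` — and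
the set of characteristics of the corresponding residue fields is infinite. -/
theorem stmt_17 (E : IntermediateField ℚ ℂ) [FiniteDimensional ℚ E] [IsGalois ℚ E]
    (n : ℕ) (z : Fin n → ↥(integralClosure ℤ E)) (hz : ∀ i, z i ≠ 0) :
    {𝔭 : Ideal ↥(integralClosure ℤ E) |
        𝔭 ≠ ⊥ ∧ 𝔭.IsPrime ∧
        (∀ x ∈ 𝔭, ∀ y : ↥(integralClosure ℤ E),
          ((y : E) : ℂ) = (starRingEnd ℂ) ((x : E) : ℂ) → y ∈ 𝔭) ∧
        (∀ i, z i ∉ 𝔭)}.Infinite ∧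
    {p : ℕ | ∃ 𝔭 : Ideal ↥(integralClosure ℤ E),
        𝔭 ≠ ⊥ ∧ 𝔭.IsPrime ∧
        (∀ x ∈ 𝔭, ∀ y : ↥(integralClosure ℤ E),
          ((y : E) : ℂ) = (starRingEnd ℂ) ((x : E) : ℂ) → y ∈ 𝔭) ∧
        (∀ i, z i ∉ 𝔭) ∧
        ringChar (↥(integralClosure ℤ E) ⧸ 𝔭) = p}.Infinite := by
  have : NumberField E := {}
  let S : Set (HeightOneSpectrum (𝓞 E)) :=
    {P | E.conj • P.asIdeal = P.asIdeal} \ ⋃ i, {P | (show 𝓞 E from z i) ∈ P.asIdeal}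
  have hS : S.Infinite := (infinite_setOf_smul_eq E.conj E.conj_mul_self).sdiff <|
    Set.finite_iUnion fun i ↦ HeightOneSpectrum.finite_setOf_mem (hz i)
  have hconj : ∀ P ∈ S, ∀ x ∈ P.asIdeal, ∀ y : 𝓞 E,
      ((y : E) : ℂ) = starRingEnd ℂ ((x : E) : ℂ) → y ∈ P.asIdeal := by
    intro P hP x hx y hy
    have hyx : y = E.conj • x := by
      ext
      exact hy.trans (E.coe_conj x).symm
    rw [hyx, ← (show E.conj • P.asIdeal = P.asIdeal from hP.1)]
    exact Ideal.smul_mem_pointwise_smul _ _ _ hx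
  have havoid : ∀ P ∈ S, ∀ i, (show 𝓞 E from z i) ∉ P.asIdeal := fun P hP i hi ↦
    hP.2 (Set.mem_iUnion_of_mem i hi)
  constructor
  · refine (hS.image (f := HeightOneSpectrum.asIdeal)
      fun _ _ _ _ ↦ HeightOneSpectrum.ext).mono ?_
    rintro _ ⟨P, hP, rfl⟩
    exact ⟨P.ne_bot, P.isPrime, hconj P hP, havoid P hP⟩
  · refine (infinite_image_ringChar_quotient hS).mono ?_
    rintro _ ⟨P, hP, rfl⟩
    exact ⟨P.asIdeal, P.ne_bot, P.isPrime, hconj P hP, havoid P hP, rfl⟩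
end
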